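/- arXiv:1212.4175 — 7 statements merged into one kernel-verified Lean document; each statement's English description precedes it below -/
import Mathlib

section
/- The union-closed sets conjecture is equivalent to the graph conjecture for bipartite graphs. That is: (every finite union-closed family 𝒳 of finite sets with 𝒳 ≠ {∅} has an element x ∈ ⋃_{X∈𝒳} X lying in at least half of the members of 𝒳) if and only if (for every finite simple graph G with a bipartition (U, W) and at least one edge, both U and W contain a rare vertex). -/
/-- A set of vertices is stable (independent): no two of its vertices are adjacent. -/
def IsStable {V : Type*} (G : SimpleGraph V) (S : Set V) : Prop :=
  ∀ ⦃u⦄, u ∈ S → ∀ ⦃v⦄, v ∈ S → ¬G.Adj u v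

/-- A maximal stable set: stable, and every vertex outside has a neighbour inside. -/
def IsMaxStable {V : Type*} (G : SimpleGraph V) (S : Set V) : Prop :=
  IsStable G S ∧ ∀ v ∉ S, ∃ u ∈ S, G.Adj v u

/-- The set of all maximal stable sets of `G`. -/
def MSS {V : Type*} (G : SimpleGraph V) : Set (Set V) := {S | IsMaxStable G S}

/-- The number of maximal stable sets of `G` containing all vertices of `X`. -/
noncomputable def mssOn {V : Type*} (G : SimpleGraph V) (X : Set V) : ℕ :=
  {S | S ∈ MSS G ∧ X ⊆ S}.ncard

/-- A vertex is rare if it lies in at most half of the maximal stable sets. -/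
def Rare {V : Type*} (G : SimpleGraph V) (v : V) : Prop :=
  2 * mssOn G {v} ≤ (MSS G).ncard

/-- The neighbourhood of a set of vertices: all vertices with a neighbour in `A`. -/
def NSet {V : Type*} (G : SimpleGraph V) (A : Set V) : Set V := {v | ∃ u ∈ A, G.Adj v u}

/-- A bipartition of `G`: a partition of the vertex set into two stable sets. -/
def IsBipartition {V : Type*} (G : SimpleGraph V) (U W : Set V) : Prop :=
  U ∪ W = Set.univ ∧ Disjoint U W ∧ IsStable G U ∧ IsStable G W

section Bipartite

variable {V : Type*} {G : SimpleGraph V} {U W : Set V}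

lemma IsBipartition.symm (h : IsBipartition G U W) : IsBipartition G W U :=
  ⟨by rw [Set.union_comm]; exact h.1, h.2.1.symm, h.2.2.2, h.2.2.1⟩

lemma IsBipartition.mem_or (h : IsBipartition G U W) (v : V) : v ∈ U ∨ v ∈ W := by
  have : v ∈ U ∪ W := h.1 ▸ Set.mem_univ v
  exact this

lemma IsBipartition.notMem_right (h : IsBipartition G U W) {v : V} (hv : v ∈ U) : v ∉ W :=
  Set.disjoint_left.1 h.2.1 hv

lemma IsBipartition.mem_right_of_adj (h : IsBipartition G U W) {u v : V} (hu : u ∈ U)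
    (huv : G.Adj u v) : v ∈ W :=
  (h.mem_or v).resolve_left fun hv => h.2.2.1 hu hv huv

lemma NSet_union (A B : Set V) : NSet G (A ∪ B) = NSet G A ∪ NSet G B := by
  ext v
  simp only [NSet, Set.mem_union, Set.mem_ofPred_eq, or_and_right, exists_or]

lemma IsBipartition.NSet_subset (h : IsBipartition G U W) {B : Set V} (hB : B ⊆ W) :
    NSet G B ⊆ U := by
  rintro v ⟨w, hw, hvw⟩
  exact h.symm.mem_right_of_adj (hB hw) hvw.symm

lemma IsBipartition.diff_eq_NSet (h : IsBipartition G U W) {S : Set V} (hS : S ∈ MSS G) :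
    U \ S = NSet G (S ∩ W) := by
  ext v
  constructor
  · rintro ⟨hvU, hvS⟩
    obtain ⟨w, hw, hvw⟩ := hS.2 v hvS
    exact ⟨w, ⟨hw, h.mem_right_of_adj hvU hvw⟩, hvw⟩
  · rintro ⟨w, ⟨hwS, hwW⟩, hvw⟩
    exact ⟨h.symm.mem_right_of_adj hwW hvw.symm, fun hvS => hS.1 hvS hwS hvw⟩

lemma IsBipartition.mem_MSS_of_NSet (h : IsBipartition G U W) {B : Set V} (hB : B ⊆ W) :
    (U \ NSet G B) ∪ (W \ NSet G (U \ NSet G B)) ∈ MSS G := by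
  constructor
  · rintro u (hu | hu) v (hv | hv) huv
    · exact h.2.2.1 hu.1 hv.1 huv
    · exact hv.2 ⟨u, hu, huv.symm⟩
    · exact hu.2 ⟨v, hv, huv⟩
    · exact h.2.2.2 hu.1 hv.1 huv
  · intro v hv
    simp only [Set.mem_union, not_or] at hv
    rcases h.mem_or v with hvU | hvW
    · obtain ⟨b, hb, hvb⟩ : v ∈ NSet G B := by_contra fun hn => hv.1 ⟨hvU, hn⟩
      refine ⟨b, Or.inr ⟨hB hb, ?_⟩, hvb⟩
      rintro ⟨a, ha, hba⟩
      exact ha.2 ⟨b, hb, hba.symm⟩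
    · obtain ⟨a, ha, hva⟩ : v ∈ NSet G (U \ NSet G B) :=
        by_contra fun hn => hv.2 ⟨hvW, hn⟩
      exact ⟨a, Or.inl ha, hva⟩

lemma IsBipartition.image_diff_MSS (h : IsBipartition G U W) :
    (U \ ·) '' MSS G = NSet G '' 𝒫 W := by
  ext Y
  constructor
  · rintro ⟨S, hS, rfl⟩
    exact ⟨S ∩ W, Set.inter_subset_right, (h.diff_eq_NSet hS).symm⟩
  · rintro ⟨B, hB, rfl⟩
    refine ⟨_, h.mem_MSS_of_NSet hB, ?_⟩
    ext v
    have hU : v ∈ NSet G B → v ∈ U := fun hv => h.NSet_subset hB hv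
    have hW : v ∈ U → v ∉ W := h.notMem_right
    simp only [Set.mem_sdiff, Set.mem_union]
    tauto

lemma IsBipartition.injOn_diff_MSS (h : IsBipartition G U W) :
    Set.InjOn (U \ ·) (MSS G) := by
  have key : ∀ S ∈ MSS G, ∀ T ∈ MSS G, U \ S = U \ T → S ⊆ T := by
    intro S hS T hT hST v hvS
    by_contra hvT
    rcases h.mem_or v with hv | hv
    · have : v ∈ U \ S := hST ▸ ⟨hv, hvT⟩
      exact this.2 hvS
    · obtain ⟨u, huT, hvu⟩ := hT.2 v hvT
      have hu : u ∈ U \ S :=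
        ⟨h.symm.mem_right_of_adj hv hvu, fun huS => hS.1 hvS huS hvu⟩
      rw [hST] at hu
      exact hu.2 huT
  exact fun S hS T hT hST =>
    Set.Subset.antisymm (key S hS T hT hST) (key T hT S hS hST.symm)

/-- Taking complements within `U`, rarity of `u ∈ U` says that `u` is in at least half of the
neighbourhoods of subsets of `W`. -/
lemma IsBipartition.rare_iff [Finite V] (h : IsBipartition G U W) {u : V} (hu : u ∈ U) :
    Rare G u ↔
      (NSet G '' 𝒫 W).ncard ≤ 2 * {Y | Y ∈ NSet G '' 𝒫 W ∧ u ∈ Y}.ncard := by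
  have hcard : (MSS G).ncard = (NSet G '' 𝒫 W).ncard := by
    rw [← h.image_diff_MSS, h.injOn_diff_MSS.ncard_image]
  have hcompl : {S | S ∈ MSS G ∧ u ∉ S}.ncard = {Y | Y ∈ NSet G '' 𝒫 W ∧ u ∈ Y}.ncard := by
    rw [← (h.injOn_diff_MSS.mono fun S hS => hS.1).ncard_image,
      ← h.image_diff_MSS]
    congr 1
    ext Y
    constructor
    · rintro ⟨S, ⟨hS, huS⟩, rfl⟩
      exact ⟨⟨S, hS, rfl⟩, hu, huS⟩
    · rintro ⟨⟨S, hS, rfl⟩, huS⟩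
      exact ⟨S, ⟨hS, huS.2⟩, rfl⟩
  have hsum : mssOn G {u} + {S | S ∈ MSS G ∧ u ∉ S}.ncard = (MSS G).ncard := by
    rw [mssOn, ← Set.ncard_union_eq]
    · congr 1
      ext S
      simp only [Set.singleton_subset_iff, Set.mem_union, Set.mem_ofPred_eq]
      tauto
    · rw [Set.disjoint_left]
      rintro S ⟨-, hS⟩ ⟨-, hS'⟩
      exact hS' (hS rfl)
  rw [Rare]
  omega

end Bipartite

lemma card_filter_coe_eq_ncard {V : Type*} [Fintype V] (P : Set V → Prop)
    [DecidablePred fun X : Finset V => P X] :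
    (Finset.univ.filter fun X : Finset V => P X).card = {Y | P Y}.ncard := by
  rw [← Set.ncard_coe_finset, ← Set.ncard_image_of_injective _ Finset.coe_injective]
  congr 1
  ext Y
  simp only [Finset.coe_filter, Finset.mem_univ, true_and, Set.mem_image, Set.mem_ofPred_eq]
  constructor
  · rintro ⟨X, hX, rfl⟩
    exact hX
  · intro hY
    exact ⟨Y.toFinite.toFinset, by simpa using hY, by simp⟩

/-- The union-closed sets conjecture. -/
def UnionClosedConjecture : Prop :=
  ∀ (α : Type) [DecidableEq α] (𝒳 : Finset (Finset α)),
    𝒳.Nonempty →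
    (∀ X ∈ 𝒳, ∀ Y ∈ 𝒳, X ∪ Y ∈ 𝒳) →
    𝒳 ≠ {∅} →
    ∃ x ∈ 𝒳.sup id, 𝒳.card ≤ 2 * (𝒳.filter (fun X => x ∈ X)).card

lemma UnionClosedConjecture.exists_rare (huc : UnionClosedConjecture) {V : Type} [Fintype V]
    {G : SimpleGraph V} {U W : Set V} (h : IsBipartition G U W) (hG : G.edgeSet.Nonempty) :
    ∃ u ∈ U, Rare G u := by
  classical
  obtain ⟨u, w, hw, huw⟩ : ∃ u, ∃ w ∈ W, G.Adj u w := by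
    obtain ⟨⟨a, b⟩, hab⟩ := hG
    have hab : G.Adj a b := hab
    rcases h.mem_or a with ha | ha
    · exact ⟨a, b, h.mem_right_of_adj ha hab, hab⟩
    · exact ⟨b, a, ha, hab.symm⟩
  let 𝒳 : Finset (Finset V) := Finset.univ.filter fun X => (X : Set V) ∈ NSet G '' 𝒫 W
  have hmem (X : Finset V) : X ∈ 𝒳 ↔ (X : Set V) ∈ NSet G '' 𝒫 W := by simp [𝒳]
  have hN : (NSet G {w}).toFinite.toFinset ∈ 𝒳 := by
    rw [hmem, Set.Finite.coe_toFinset]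
    exact ⟨{w}, by simpa using hw, rfl⟩
  obtain ⟨x, hx, hcard⟩ := huc V 𝒳 ⟨_, hN⟩
    (by
      intro X hX Y hY
      rw [hmem] at hX hY ⊢
      obtain ⟨A, hA, hAX⟩ := hX
      obtain ⟨B, hB, hBY⟩ := hY
      exact ⟨A ∪ B, Set.union_subset hA hB, by rw [NSet_union, hAX, hBY, Finset.coe_union]⟩)
    (by
      intro h𝒳
      rw [h𝒳, Finset.mem_singleton, Set.Finite.toFinset_eq_empty] at hN
      have hu : u ∈ NSet G {w} := ⟨w, rfl, huw⟩
      rw [hN] at hu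
      exact hu)
  have hxU : x ∈ U := by
    obtain ⟨X, hX, hxX⟩ := Finset.mem_sup.1 hx
    obtain ⟨B, hB, hBX⟩ := (hmem X).1 hX
    exact h.NSet_subset hB (hBX ▸ Finset.mem_coe.2 hxX)
  refine ⟨x, hxU, (h.rare_iff hxU).2 ?_⟩
  have h₁ : 𝒳.card = (NSet G '' 𝒫 W).ncard :=
    card_filter_coe_eq_ncard (· ∈ NSet G '' 𝒫 W)
  have h₂ : (𝒳.filter fun X => x ∈ X).card = {Y | Y ∈ NSet G '' 𝒫 W ∧ x ∈ Y}.ncard := by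
    rw [← card_filter_coe_eq_ncard fun Y => Y ∈ NSet G '' 𝒫 W ∧ x ∈ Y]
    congr 1
    ext X
    simp [𝒳]
  rwa [h₁, h₂] at hcard

section Incidence

variable {α : Type*} [DecidableEq α] (𝒳 : Finset (Finset α))

/-- The elements (on the left) and the members (on the right) of a set family. -/
abbrev IncidenceVertex : Type _ := ↥(𝒳.sup id) ⊕ ↥𝒳

/-- The incidence graph of a set family. -/
def incidenceGraph : SimpleGraph (IncidenceVertex 𝒳) where
  Adj
    | .inl x, .inr X => x.1 ∈ X.1
    | .inr X, .inl x => x.1 ∈ X.1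
    | _, _ => False
  symm := ⟨by rintro (_ | _) (_ | _) h <;> exact h⟩
  loopless := ⟨by rintro (_ | _) h <;> exact h⟩

lemma isBipartition_incidenceGraph :
    IsBipartition (incidenceGraph 𝒳) (Set.range Sum.inl) (Set.range Sum.inr) := by
  refine ⟨Set.range_inl_union_range_inr, Set.isCompl_range_inl_range_inr.disjoint, ?_, ?_⟩
  · rintro _ ⟨x, rfl⟩ _ ⟨y, rfl⟩ h
    exact h
  · rintro _ ⟨x, rfl⟩ _ ⟨y, rfl⟩ h
    exact h

/-- A set of elements viewed as a set of left vertices of the incidence graph. -/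
def leftVertices (X : Finset α) : Set (IncidenceVertex 𝒳) := Sum.inl '' {x | x.1 ∈ X}

variable {𝒳}

lemma inl_mem_leftVertices {x : ↥(𝒳.sup id)} {X : Finset α} :
    Sum.inl x ∈ leftVertices 𝒳 X ↔ x.1 ∈ X := by
  simp [leftVertices]

lemma injOn_leftVertices :
    Set.InjOn (leftVertices 𝒳) (insert ∅ 𝒳 : Finset (Finset α)) := by
  have key : ∀ X ∈ insert ∅ 𝒳, ∀ Y, leftVertices 𝒳 X = leftVertices 𝒳 Y → X ⊆ Y := by
    intro X hX Y hXY x hx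
    have hX' : X ∈ 𝒳 := (Finset.mem_insert.1 hX).resolve_left fun h => by simp [h] at hx
    have hx' : x ∈ 𝒳.sup id := Finset.mem_sup.2 ⟨X, hX', hx⟩
    have hmem : Sum.inl ⟨x, hx'⟩ ∈ leftVertices 𝒳 X := inl_mem_leftVertices.2 hx
    rw [hXY] at hmem
    exact inl_mem_leftVertices.1 hmem
  exact fun X hX Y hY hXY =>
    Finset.Subset.antisymm (key X hX Y hXY) (key Y hY X hXY.symm)

lemma NSet_incidenceGraph_inr (B : Finset 𝒳) :
    NSet (incidenceGraph 𝒳) (Sum.inr '' (B : Set 𝒳)) =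
      leftVertices 𝒳 (B.sup Subtype.val) := by
  ext (x | X)
  · rw [inl_mem_leftVertices, Finset.mem_sup]
    constructor
    · rintro ⟨_, ⟨X, hX, rfl⟩, hxX⟩
      exact ⟨X, hX, hxX⟩
    · rintro ⟨X, hX, hxX⟩
      exact ⟨_, ⟨X, hX, rfl⟩, hxX⟩
  · constructor
    · rintro ⟨_, ⟨Y, _, rfl⟩, h⟩
      exact h.elim
    · rintro ⟨x, _, hx⟩
      cases hx

lemma image_NSet_incidenceGraph (hunion : ∀ X ∈ 𝒳, ∀ Y ∈ 𝒳, X ∪ Y ∈ 𝒳) :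
    NSet (incidenceGraph 𝒳) '' 𝒫 (Set.range Sum.inr) =
      leftVertices 𝒳 '' (insert ∅ 𝒳 : Finset (Finset α)) := by
  classical
  ext Y
  constructor
  · rintro ⟨B, hB, rfl⟩
    obtain ⟨C, rfl⟩ := Set.subset_range_iff_exists_image_eq.1 hB
    obtain ⟨D, rfl⟩ : ∃ D : Finset 𝒳, (D : Set 𝒳) = C :=
      ⟨C.toFinite.toFinset, by simp⟩
    refine ⟨D.sup Subtype.val, ?_, (NSet_incidenceGraph_inr D).symm⟩
    refine Finset.sup_induction (p := (· ∈ insert ∅ 𝒳)) (Finset.mem_insert_self _ _) ?_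
      fun X _ => Finset.mem_insert_of_mem X.2
    intro X hX Y hY
    rcases Finset.mem_insert.1 hX with rfl | hX
    · simpa using hY
    · rcases Finset.mem_insert.1 hY with rfl | hY
      · simpa using Or.inr hX
      · exact Finset.mem_insert_of_mem (hunion X hX Y hY)
  · rintro ⟨X, hX, rfl⟩
    rcases Finset.mem_insert.1 hX with rfl | hX
    · refine ⟨_, Set.image_subset_range _ _, (NSet_incidenceGraph_inr ∅).trans ?_⟩
      simp
    · refine ⟨_, Set.image_subset_range _ _, (NSet_incidenceGraph_inr {⟨X, hX⟩}).trans ?_⟩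
      simp

lemma card_le_of_rare_incidenceGraph (hunion : ∀ X ∈ 𝒳, ∀ Y ∈ 𝒳, X ∪ Y ∈ 𝒳)
    {x : ↥(𝒳.sup id)} (hx : Rare (incidenceGraph 𝒳) (Sum.inl x)) :
    𝒳.card ≤ 2 * (𝒳.filter fun X => x.1 ∈ X).card := by
  rw [(isBipartition_incidenceGraph 𝒳).rare_iff ⟨x, rfl⟩, image_NSet_incidenceGraph hunion,
    injOn_leftVertices.ncard_image, Set.ncard_coe_finset] at hx
  have hsub : {Y | Y ∈ leftVertices 𝒳 '' (insert ∅ 𝒳 : Finset (Finset α)) ∧ Sum.inl x ∈ Y} ⊆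
      leftVertices 𝒳 '' (𝒳.filter fun X => x.1 ∈ X : Finset (Finset α)) := by
    rintro _ ⟨⟨X, hX, rfl⟩, hxX⟩
    have hxX := inl_mem_leftVertices.1 hxX
    have hX' : X ∈ 𝒳 := (Finset.mem_insert.1 hX).resolve_left fun h => by simp [h] at hxX
    exact ⟨X, Finset.mem_filter.2 ⟨hX', hxX⟩, rfl⟩
  have hle := (Set.ncard_le_ncard hsub).trans (Set.ncard_image_le (Finset.finite_toSet _))
  rw [Set.ncard_coe_finset] at hle
  have hins : 𝒳.card ≤ (insert ∅ 𝒳).card := Finset.card_le_card (Finset.subset_insert _ _)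
  omega

lemma edgeSet_incidenceGraph_nonempty (hne : 𝒳.Nonempty) (h𝒳 : 𝒳 ≠ {∅}) :
    (incidenceGraph 𝒳).edgeSet.Nonempty := by
  obtain ⟨X, hX, x, hx⟩ : ∃ X ∈ 𝒳, X.Nonempty := by
    by_contra! hcon
    exact h𝒳 (Finset.eq_singleton_iff_nonempty_unique_mem.2 ⟨hne, hcon⟩)
  exact ⟨s(Sum.inl ⟨x, Finset.mem_sup.2 ⟨X, hX, hx⟩⟩, Sum.inr ⟨X, hX⟩), hx⟩

end Incidence


/-- The union-closed sets conjecture is equivalent to the graph conjecture: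
every finite non-trivial union-closed family has an element in at least half the members
iff every finite bipartite graph with an edge has a rare vertex in each bipartition class. -/
theorem union_closed_iff_bipartite_rare :
    (∀ (α : Type) [DecidableEq α] (𝒳 : Finset (Finset α)),
        𝒳.Nonempty →
        (∀ X ∈ 𝒳, ∀ Y ∈ 𝒳, X ∪ Y ∈ 𝒳) →
        𝒳 ≠ {∅} →
        ∃ x ∈ 𝒳.sup id, 𝒳.card ≤ 2 * (𝒳.filter (fun X => x ∈ X)).card) ↔
    (∀ (V : Type) [Fintype V] (G : SimpleGraph V) (U W : Set V),
        IsBipartition G U W → G.edgeSet.Nonempty →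
        (∃ u ∈ U, Rare G u) ∧ (∃ w ∈ W, Rare G w)) := by
  refine ⟨fun huc V _ G U W h hG =>
    ⟨UnionClosedConjecture.exists_rare huc h hG,
      UnionClosedConjecture.exists_rare huc h.symm hG⟩, ?_⟩
  intro hgraph α _ 𝒳 hne hunion h𝒳
  obtain ⟨⟨_, ⟨x, rfl⟩, hx⟩, -⟩ := hgraph _ (incidenceGraph 𝒳) _ _
    (isBipartition_incidenceGraph 𝒳) (edgeSet_incidenceGraph_nonempty hne h𝒳)
  exact ⟨x, x.2, card_le_of_rare_incidenceGraph hunion hx⟩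
end

section
/- The following two statements are equivalent: (1) every finite simple graph with at least one edge has two adjacent vertices each of which is rare; (2) for every finite simple graph G with a bipartition (U, W) and at least one edge, both U and W contain a rare vertex. -/
/-- At least one endpoint of every edge is rare. -/
theorem SimpleGraph.Adj.rare_or_rare {V : Type*} [Finite V] {G : SimpleGraph V} {u v : V}
    (h : G.Adj u v) : Rare G u ∨ Rare G v := by
  have hle : mssOn G {u} + mssOn G {v} ≤ (MSS G).ncard := by
    unfold mssOn
    rw [← Set.ncard_union_eq _ (Set.toFinite _) (Set.toFinite _)]
    · exact Set.ncard_le_ncard (Set.union_subset (fun _ hS => hS.1) fun _ hS => hS.1)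
        (Set.toFinite _)
    · exact Set.disjoint_left.2 fun S hu hv =>
        hu.1.1 (Set.singleton_subset_iff.1 hu.2) (Set.singleton_subset_iff.1 hv.2) h
  unfold Rare
  lia

/-- The conjecture that every finite graph with an edge has two adjacent rare vertices
is equivalent to the conjecture that every finite bipartite graph with an edge has a
rare vertex in each bipartition class. -/
theorem adjacent_rare_iff_bipartite_rare :
    (∀ (V : Type) [Fintype V] (G : SimpleGraph V), G.edgeSet.Nonempty →
        ∃ u v, G.Adj u v ∧ Rare G u ∧ Rare G v) ↔
    (∀ (V : Type) [Fintype V] (G : SimpleGraph V) (U W : Set V),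
        IsBipartition G U W → G.edgeSet.Nonempty →
        (∃ u ∈ U, Rare G u) ∧ (∃ w ∈ W, Rare G w)) := by
  constructor
  · intro h V _ G U W ⟨hcover, _, hU, hW⟩ hE
    obtain ⟨u, v, huv, hu, hv⟩ := h V G hE
    have hmem : ∀ x, x ∈ U ∨ x ∈ W := fun x => hcover.ge (Set.mem_univ x)
    rcases hmem u with huU | huW <;> rcases hmem v with hvU | hvW
    · exact absurd huv (hU huU hvU)
    · exact ⟨⟨u, huU, hu⟩, v, hvW, hv⟩
    · exact ⟨⟨v, hvU, hv⟩, u, huW, hu⟩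
    · exact absurd huv (hW huW hvW)
  · intro h V _ G hE
    by_contra! hno
    obtain ⟨w, hw, hw'⟩ := (h V G {x | Rare G x} {x | Rare G x}ᶜ
      ⟨Set.union_compl_self _, disjoint_compl_right,
        fun u hu v hv huv => hno u v huv hu hv,
        fun u hu v hv huv => huv.rare_or_rare.elim hu hv⟩ hE).2
    exact hw hw'
end

section
/- If u and v are adjacent vertices of a finite simple graph G, then |MSS_u(G)| + |MSS_v(G)| ≤ |MSS(G)|; consequently at least one of u and v is rare. -/
/-- For adjacent vertices `u, v`: `|MSS_u| + |MSS_v| ≤ |MSS|`, hence one of them is rare. -/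
theorem adjacent_mss_sum_le {V : Type} [Fintype V] (G : SimpleGraph V) (u v : V)
    (huv : G.Adj u v) :
    mssOn G {u} + mssOn G {v} ≤ (MSS G).ncard ∧ (Rare G u ∨ Rare G v) := by
  have hdisj : Disjoint {S | S ∈ MSS G ∧ {u} ⊆ S} {S | S ∈ MSS G ∧ {v} ⊆ S} :=
    Set.disjoint_left.2 fun _ hu hv ↦
      hu.1.1 (Set.singleton_subset_iff.1 hu.2) (Set.singleton_subset_iff.1 hv.2) huv
  have hsum : mssOn G {u} + mssOn G {v} ≤ (MSS G).ncard := by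
    rw [mssOn, mssOn, ← Set.ncard_union_eq hdisj]
    exact Set.ncard_le_ncard (Set.union_subset (fun _ h ↦ h.1) fun _ h ↦ h.1)
  refine ⟨hsum, ?_⟩
  unfold Rare
  omega
end

section
/- Let G be a finite simple graph with bipartition (U, W), and let S and T be maximal stable sets of G. Then the set (U ∩ S ∩ T) ∪ (W \ N(S ∩ T)) is a maximal stable set of G. -/
/-- In a bipartite graph with bipartition `(U, W)`, if `S` and `T` are maximal stable sets
then so is `(U ∩ S ∩ T) ∪ (W \ N(S ∩ T))`. -/
theorem maxStable_cap {V : Type} [Fintype V] (G : SimpleGraph V) (U W : Set V)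
    (hb : IsBipartition G U W) (S T : Set V) (hS : IsMaxStable G S) (hT : IsMaxStable G T) :
    IsMaxStable G ((U ∩ S ∩ T) ∪ (W \ NSet G (S ∩ T))) := by
  obtain ⟨hUW, -, hU, hW⟩ := hb
  have cover (v : V) : v ∈ U ∨ v ∈ W := Set.eq_univ_iff_forall.mp hUW v
  constructor
  · rintro u (⟨⟨huU, huS⟩, huT⟩ | ⟨huW, huN⟩) v (⟨⟨hvU, hvS⟩, hvT⟩ | ⟨hvW, hvN⟩) huv
    · exact hU huU hvU huv
    · exact hvN ⟨u, ⟨huS, huT⟩, huv.symm⟩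
    · exact huN ⟨v, ⟨hvS, hvT⟩, huv⟩
    · exact hW huW hvW huv
  · intro v hv
    rcases cover v with hvU | hvW
    · have hST : v ∉ S ∨ v ∉ T := by
        by_contra! h
        exact hv (Or.inl ⟨⟨hvU, h.1⟩, h.2⟩)
      rcases hST with hvS | hvT
      · obtain ⟨w, hwS, hvw⟩ := hS.2 v hvS
        exact ⟨w, Or.inr ⟨(cover w).resolve_left fun hwU => hU hvU hwU hvw,
          fun ⟨x, hx, hwx⟩ => hS.1 hwS hx.1 hwx⟩, hvw⟩
      · obtain ⟨w, hwT, hvw⟩ := hT.2 v hvT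
        exact ⟨w, Or.inr ⟨(cover w).resolve_left fun hwU => hU hvU hwU hvw,
          fun ⟨x, hx, hwx⟩ => hT.1 hwT hx.2 hwx⟩, hvw⟩
    · have hvN : v ∈ NSet G (S ∩ T) := by
        by_contra h
        exact hv (Or.inr ⟨hvW, h⟩)
      obtain ⟨u, hu, hvu⟩ := hvN
      exact ⟨u, Or.inl ⟨⟨(cover u).resolve_right fun huW => hW hvW huW hvu, hu.1⟩, hu.2⟩, hvu⟩
end

section
/- Let G be a finite simple graph with bipartition (U, W). Then the map S ↦ U \ S is injective on the set of maximal stable sets of G, and the family 𝒳 = {U \ S : S ∈ MSS(G)} is union-closed. Moreover, if G has at least one edge then 𝒳 ≠ {∅}. -/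
namespace IsBipartition

variable {V : Type*} {G : SimpleGraph V} {U W : Set V}

theorem mem_or_mem (hb : IsBipartition G U W) (v : V) : v ∈ U ∨ v ∈ W := by
  have h : v ∈ U ∪ W := hb.1 ▸ Set.mem_univ v
  exact h

theorem notMem_left (hb : IsBipartition G U W) {v : V} (hv : v ∈ W) : v ∉ U :=
  fun hu => Set.disjoint_left.1 hb.2.1 hu hv

theorem mem_right_of_adj_s5 (hb : IsBipartition G U W) {u v : V} (hu : u ∈ U) (h : G.Adj u v) :
    v ∈ W :=
  (hb.mem_or_mem v).resolve_left fun hv => hb.2.2.1 hu hv h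

theorem mem_left_of_adj (hb : IsBipartition G U W) {u v : V} (hu : u ∈ W) (h : G.Adj u v) :
    v ∈ U :=
  (hb.mem_or_mem v).resolve_right fun hv => hb.2.2.2 hu hv h

/-- A maximal stable set is contained in any other one with the same complement in `U`. -/
theorem subset_of_diff_eq (hb : IsBipartition G U W) {S T : Set V} (hS : S ∈ MSS G)
    (hT : T ∈ MSS G) (h : U \ S = U \ T) : S ⊆ T := by
  have key : ∀ u ∈ U, u ∈ S ↔ u ∈ T := fun u hu => by
    have := Set.ext_iff.1 h u
    simp only [Set.mem_sdiff, hu, true_and] at this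
    exact not_iff_not.1 this
  intro v hv
  rcases hb.mem_or_mem v with hU | hW
  · exact (key v hU).1 hv
  · by_contra hvT
    obtain ⟨u, hu, hadj⟩ := hT.2 v hvT
    exact hS.1 hv ((key u (hb.mem_left_of_adj hW hadj)).2 hu) hadj

/-- A set `A ⊆ U` extends to a maximal stable set with trace `A` on `U` if every vertex of
`U \ A` has a neighbour that has no neighbour in `A`. -/
theorem diff_mem_image (hb : IsBipartition G U W) {A : Set V} (hA : A ⊆ U)
    (h : ∀ u ∈ U, u ∉ A → ∃ w, G.Adj u w ∧ w ∉ NSet G A) :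
    U \ A ∈ (fun S => U \ S) '' MSS G := by
  refine ⟨A ∪ (W \ NSet G A), ⟨?_, ?_⟩, ?_⟩
  · rintro u (hu | hu) v (hv | hv) hadj
    · exact hb.2.2.1 (hA hu) (hA hv) hadj
    · exact hv.2 ⟨u, hu, hadj.symm⟩
    · exact hu.2 ⟨v, hv, hadj⟩
    · exact hb.2.2.2 hu.1 hv.1 hadj
  · intro v hv
    rcases hb.mem_or_mem v with hU | hW
    · obtain ⟨w, hadj, hw⟩ := h v hU fun hvA => hv (Or.inl hvA)
      exact ⟨w, Or.inr ⟨hb.mem_right_of_adj_s5 hU hadj, hw⟩, hadj⟩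
    · by_contra hn
      exact hv (Or.inr ⟨hW, fun ⟨u, hu, hadj⟩ => hn ⟨u, Or.inl hu, hadj⟩⟩)
  · ext v
    constructor
    · exact fun hv => ⟨hv.1, fun hvA => hv.2 (Or.inl hvA)⟩
    · rintro ⟨hU, hvA⟩
      exact ⟨hU, fun hv => hv.elim hvA fun hw => hb.notMem_left hw.1 hU⟩

end IsBipartition

/-- For a bipartite graph with bipartition `(U, W)`, the map `S ↦ U \ S` is injective on the
maximal stable sets, the family `{U \ S : S ∈ MSS(G)}` is union-closed, and if `G` has an
edge then this family is not `{∅}`. -/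
theorem compl_map_injOn_unionClosed {V : Type} [Fintype V] (G : SimpleGraph V) (U W : Set V)
    (hb : IsBipartition G U W) :
    Set.InjOn (fun S => U \ S) (MSS G) ∧
    (∀ X ∈ (fun S => U \ S) '' MSS G, ∀ Y ∈ (fun S => U \ S) '' MSS G,
      X ∪ Y ∈ (fun S => U \ S) '' MSS G) ∧
    (G.edgeSet.Nonempty → (fun S => U \ S) '' MSS G ≠ {∅}) := by
  refine ⟨fun S hS T hT h => (hb.subset_of_diff_eq hS hT h).antisymm
    (hb.subset_of_diff_eq hT hS h.symm), ?_, ?_⟩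
  · rintro _ ⟨S, hS, rfl⟩ _ ⟨T, hT, rfl⟩
    have heq : U \ S ∪ U \ T = U \ (U ∩ (S ∩ T)) := by
      rw [Set.sdiff_self_inter, Set.sdiff_inter]
    simp only [heq]
    refine hb.diff_mem_image Set.inter_subset_left fun u hu hn => ?_
    by_cases huS : u ∈ S
    · have huT : u ∉ T := fun huT => hn ⟨hu, huS, huT⟩
      obtain ⟨w, hw, hadj⟩ := hT.2 u huT
      exact ⟨w, hadj, fun ⟨x, hx, hwx⟩ => hT.1 hw hx.2.2 hwx⟩
    · obtain ⟨w, hw, hadj⟩ := hS.2 u huS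
      exact ⟨w, hadj, fun ⟨x, hx, hwx⟩ => hS.1 hw hx.2.1 hwx⟩
  · rintro ⟨e, he⟩ heq
    obtain ⟨u, v, hu, hadj⟩ : ∃ u v, u ∈ U ∧ G.Adj u v := by
      induction e using Sym2.ind with
      | _ a b =>
        have hab : G.Adj a b := he
        rcases hb.mem_or_mem a with ha | ha
        · exact ⟨a, b, ha, hab⟩
        · exact ⟨b, a, hb.mem_left_of_adj ha hab, hab.symm⟩
    have hmem := hb.diff_mem_image (A := {x | x ∈ U ∧ ∀ y, ¬G.Adj x y}) (fun x hx => hx.1)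
      fun x hx hn => by
        have hex : ∃ y, G.Adj x y := by
          by_contra hno
          exact hn ⟨hx, fun y hy => hno ⟨y, hy⟩⟩
        obtain ⟨y, hy⟩ := hex
        exact ⟨y, hy, fun ⟨z, hz, hyz⟩ => hz.2 y hyz.symm⟩
    rw [heq, Set.mem_singleton_iff] at hmem
    exact Set.notMem_empty u (hmem ▸ ⟨hu, fun h => h.2 v hadj⟩)
end

section
/- Let G be a finite bipartite graph with bipartition (U, W), at least one edge, and maximum degree at most 3. Then both U and W contain a rare vertex. -/
/-- The restriction of a union-closed family to a fixed trace outside seven elements is given by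
two indicator functions on `{0, 1}⁶`: `x` without and `y` with the common element of three members
`{w, bᵢ, cᵢ}`. The weights `2` on `w` and `3` on the other elements have nonnegative total. -/
lemma disjoint_links_inequality (x y : Bool → Bool → Bool → Bool → Bool → Bool → ℤ)
    (hx0 : ∀ a b c d e f, 0 ≤ x a b c d e f) (hx1 : ∀ a b c d e f, x a b c d e f ≤ 1)
    (hy1 : ∀ a b c d e f, y a b c d e f ≤ 1)
    (hun : ∀ a b c d e f a' b' c' d' e' f', x a b c d e f + x a' b' c' d' e' f' ≤
      1 + x (a || a') (b || b') (c || c') (d || d') (e || e') (f || f'))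
    (h1 : ∀ a b c d e f, x a b c d e f ≤ y true true c d e f)
    (h2 : ∀ a b c d e f, x a b c d e f ≤ y a b true true e f)
    (h3 : ∀ a b c d e f, x a b c d e f ≤ y a b c d true true)
    (k1 : ∀ a b c d e f, y a b c d e f ≤ y true true c d e f)
    (k2 : ∀ a b c d e f, y a b c d e f ≤ y a b true true e f)
    (k3 : ∀ a b c d e f, y a b c d e f ≤ y a b c d true true)
    (hz : ∀ a b c d e f, (a && b) = false → (c && d) = false → (e && f) = false →
      y a b c d e f = 0) :
    0 ≤ ∑ a, ∑ b, ∑ c, ∑ d, ∑ e, ∑ f,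
      ((3 * (a.toNat + b.toNat + c.toNat + d.toNat + e.toNat + f.toNat) - 10) * x a b c d e f +
       (3 * (a.toNat + b.toNat + c.toNat + d.toNat + e.toNat + f.toNat) - 8) * y a b c d e f) := by
  have hcluster : 4 * (x true true false false false false + x false false true true false false
        + x false false false false true true)
      + 2 * (y true true false false false false + y false false true true false false
        + y false false false false true true)
      ≤ 2 * (x true true true true false false + x true true false false true true
        + x false false true true true true)
      + 4 * (y true true true true false false + y true true false false true true
        + y false false true true true true) := by
    have a1 := hun true true false false false false false false true true false false
    have a2 := hun true true false false false false false false false false true true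
    have a3 := hun false false true true false false false false false false true true
    have b1 := h1 true true false false false false
    have b2 := h2 false false true true false false
    have b3 := h3 false false false false true true
    have c1 := k2 true true false false false false
    have c2 := k3 true true false false false false
    have c3 := k1 false false true true false false
    have c4 := k3 false false true true false false
    have c5 := k1 false false false false true true
    have c6 := k2 false false false false true true
    have d1 := hx0 true true true true false false
    have d2 := hx0 true true false false true true
    have d3 := hx0 false false true true true true
    have d4 := hx0 true true false false false false
    have d5 := hx0 false false true true false false
    have d6 := hx0 false false false false true true
    have e1 := hy1 true true true true false false
    have e2 := hy1 true true false false true true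
    have e3 := hy1 false false true true true true
    simp only [Bool.or_false, Bool.or_true] at a1 a2 a3
    omega
  have htriple : ∀ p q r : Bool, 4 * x p (!p) q (!q) r (!r) ≤
      5 * (y true true true true true true - x false false false false false false)
      + 7 * ((y p (!p) true true true true - x p (!p) false false false false)
        + (y true true q (!q) true true - x false false q (!q) false false)
        + (y true true true true r (!r) - x false false false false r (!r)))
      + 8 * ((y p (!p) q (!q) true true - x p (!p) q (!q) false false)
        + (y p (!p) true true r (!r) - x p (!p) false false r (!r))
        + (y true true q (!q) r (!r) - x false false q (!q) r (!r)))
      + 4 * (x p (!p) q (!q) true true + x p (!p) true true r (!r) + x true true q (!q) r (!r))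
      + ((y p (!p) true true false false - x p (!p) true true false false)
        + (y p (!p) false false true true - x p (!p) false false true true)
        + (y true true q (!q) false false - x true true q (!q) false false)
        + (y false false q (!q) true true - x false false q (!q) true true)
        + (y true true false false r (!r) - x true true false false r (!r))
        + (y false false true true r (!r) - x false false true true r (!r))) := by
    intro p q r
    have a0 := (h1 false false false false false false).trans
      ((k2 _ _ _ _ _ _).trans (k3 _ _ _ _ _ _))
    have a1 := (h2 p (!p) false false false false).trans (k3 _ _ _ _ _ _)
    have a2 := (h1 false false q (!q) false false).trans (k3 _ _ _ _ _ _)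
    have a3 := (h1 false false false false r (!r)).trans (k2 _ _ _ _ _ _)
    have a4 := h3 p (!p) q (!q) false false
    have a5 := h2 p (!p) false false r (!r)
    have a6 := h1 false false q (!q) r (!r)
    have b1 := h2 p (!p) true true false false
    have b2 := h3 p (!p) false false true true
    have b3 := h1 true true q (!q) false false
    have b4 := h3 false false q (!q) true true
    have b5 := h1 true true false false r (!r)
    have b6 := h2 false false true true r (!r)
    have c0 := (h1 p (!p) q (!q) r (!r)).trans ((k2 _ _ _ _ _ _).trans (k3 _ _ _ _ _ _))
    have c1 := (h2 p (!p) q (!q) r (!r)).trans (k3 _ _ _ _ _ _)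
    have c2 := (h1 p (!p) q (!q) r (!r)).trans (k3 _ _ _ _ _ _)
    have c3 := (h1 p (!p) q (!q) r (!r)).trans (k2 _ _ _ _ _ _)
    have c4 := h3 p (!p) q (!q) r (!r)
    have c5 := h2 p (!p) q (!q) r (!r)
    have c6 := h1 p (!p) q (!q) r (!r)
    have d1 := h2 p (!p) false false false false
    have d2 := h3 p (!p) false false false false
    have d3 := h1 false false q (!q) false false
    have d4 := h3 false false q (!q) false false
    have d5 := h1 false false false false r (!r)
    have d6 := h2 false false false false r (!r)
    have e1 := hun p (!p) true true false false p (!p) q (!q) r (!r)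
    have e2 := hun p (!p) false false true true p (!p) q (!q) r (!r)
    have e3 := hun true true q (!q) false false p (!p) q (!q) r (!r)
    have e4 := hun false false q (!q) true true p (!p) q (!q) r (!r)
    have e5 := hun true true false false r (!r) p (!p) q (!q) r (!r)
    have e6 := hun false false true true r (!r) p (!p) q (!q) r (!r)
    simp only [Bool.false_or, Bool.true_or, Bool.or_self]
      at e1 e2 e3 e4 e5 e6
    have f1 := hx0 p (!p) q (!q) true true
    have f2 := hx0 p (!p) true true r (!r)
    have f3 := hx0 true true q (!q) r (!r)
    have g0 := hx0 p (!p) q (!q) r (!r)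
    have g1 := hx1 p (!p) q (!q) r (!r)
    obtain h | h : x p (!p) q (!q) r (!r) = 0 ∨ x p (!p) q (!q) r (!r) = 1 := by omega
    all_goals linarith
  have hsum := Finset.sum_nonneg (s := Finset.univ) (fun p (_ : p ∈ Finset.univ) =>
    Finset.sum_nonneg (s := Finset.univ) (fun q (_ : q ∈ Finset.univ) =>
    Finset.sum_nonneg (s := Finset.univ) (fun r (_ : r ∈ Finset.univ) =>
      sub_nonneg.2 (htriple p q r))))
  simp only [Fintype.sum_bool, Bool.not_true, Bool.not_false] at hsum
  have z := fun a b c d e f h h' h'' => hz a b c d e f h h' h''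
  simp only [Bool.forall_bool, Bool.and_true, Bool.and_false, forall_const, reduceCtorEq,
    IsEmpty.forall_iff, and_true] at z
  simp only [Fintype.sum_bool, Bool.toNat_true, Bool.toNat_false, Nat.cast_one, Nat.cast_zero, z]
  have p0 := hx0 true true true true true true
  have p1 := hx0 true true true true true false
  have p2 := hx0 true true true true false true
  have p3 := hx0 true true true false true true
  have p4 := hx0 true true false true true true
  have p5 := hx0 true false true true true true
  have p6 := hx0 false true true true true true
  linarith

/-- The analogue of `disjoint_links_inequality` for three members of which two share a second
element. -/
lemma path_links_inequality (x y : Bool → Bool → Bool → Bool → Bool → ℤ)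
    (hx0 : ∀ b c d e f, 0 ≤ x b c d e f) (hx1 : ∀ b c d e f, x b c d e f ≤ 1)
    (hy0 : ∀ b c d e f, 0 ≤ y b c d e f) (hy1 : ∀ b c d e f, y b c d e f ≤ 1)
    (hun : ∀ b c d e f b' c' d' e' f', x b c d e f + x b' c' d' e' f' ≤
      1 + x (b || b') (c || c') (d || d') (e || e') (f || f'))
    (h1 : ∀ b c d e f, x b c d e f ≤ y true true d e f)
    (h2 : ∀ b c d e f, x b c d e f ≤ y true c true e f)
    (h3 : ∀ b c d e f, x b c d e f ≤ y b c d true true)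
    (k1 : ∀ b c d e f, y b c d e f ≤ y true true d e f)
    (k2 : ∀ b c d e f, y b c d e f ≤ y true c true e f)
    (k3 : ∀ b c d e f, y b c d e f ≤ y b c d true true)
    (hz : ∀ b c d e f, (b && c) = false → (b && d) = false → (e && f) = false →
      y b c d e f = 0) :
    0 ≤ ∑ b, ∑ c, ∑ d, ∑ e, ∑ f,
      ((2 * (2 * b.toNat + c.toNat + d.toNat + e.toNat + f.toNat) - 7) * x b c d e f +
       (2 * (2 * b.toNat + c.toNat + d.toNat + e.toNat + f.toNat) - 5) * y b c d e f) := by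
  have hb : ∀ e : Bool, x true false false e (!e) ≤
      (x true true false e (!e) + 3 * (y true true false e (!e) - x false true false e (!e))) := by
    intro e
    have a1 := h1 true false false e (!e)
    have a2 := h1 false true false e (!e)
    have a3 := hun true false false e (!e) false true false e (!e)
    simp only [Bool.or_false, Bool.or_true, Bool.or_self] at a3
    have a4 := hx1 true false false e (!e)
    have a5 := hx0 true true false e (!e)
    have a6 := hx0 false true false e (!e)
    omega
  have hcd : x false true true true false + x false true true false true
      + 3 * x false false false true true + y false false false true true ≤
      3 * y true true true false false + x true true true false false
      + (y true true false false false - x true true false false false)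
      + (y true false true false false - x true false true false false)
      + 5 * (y true true false true true - x false true false false false)
      + 5 * (y true false true true true - x false false true false false)
      + 3 * (x true true false true true + x true false true true true)
      + x false true true true true
      + 7 * (y true true true true true - x false false false false false)
      + 5 * (y true true true true false - x false false false true false)
      + 5 * (y true true true false true - x false false false false true) := by
    have a1 := h1 true true false false false
    have a2 := h2 true false true false false
    have a3 := (h1 false true false false false).trans (k3 _ _ _ _ _)
    have a4 := (h2 false false true false false).trans (k3 _ _ _ _ _)
    have a5 := (h1 false false false false false).trans ((k2 _ _ _ _ _).trans (k3 _ _ _ _ _))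
    have a6 := (h1 false false false true false).trans (k2 _ _ _ _ _)
    have a7 := (h1 false false false false true).trans (k2 _ _ _ _ _)
    have b1 := (h1 false true true true false)
    have b2 := (h1 false true true false true)
    have b3 := k3 true true true true false
    have b4 := k3 true true true false true
    have b5 := h3 false false false true true
    have b6 := k1 false false false true true
    have b7 := k2 false false false true true
    have b8 := k2 true true false true true
    have c1 := (h1 false false false false false)
    have c2 := (h2 false false false false false)
    have c3 := (k2 true true false false false)
    have c4 := h3 false false false true false
    have c5 := h3 false false false false true
    have d1 := hun true true false false false false false false true true
    have d2 := hun true false true false false false false false true true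
    have d3 := hun false true true true false false false false true true
    have d4 := hun false true true false true false false false true true
    have d5 := hun false true false false false false false true false false
    have d6 := hun false true true false false false false false true true
    simp only [Bool.or_false, Bool.or_true, Bool.or_self]
      at d1 d2 d3 d4 d5 d6
    have d7 := h1 false true true false false
    have e1 := hx0 true true true false false
    have e2 := hx0 true true false true true
    have e3 := hx0 true false true true true
    have e4 := hx0 false true true true true
    have f1 := hx1 false false false true true
    have f2 := hx0 false false false true true
    have f3 := hx1 false true true true false
    have f4 := hx0 false true true true false
    have f5 := hx1 false true true false true
    have f6 := hx0 false true true false true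
    have f7 := hy1 false false false true true
    have f8 := hy0 false false false true true
    have g1 := hx1 false false false false false
    have g2 := hx0 false false false false false
    have g3 := hx1 false true false false false
    have g4 := hx0 false true false false false
    have g5 := hx1 false false true false false
    have g6 := hx0 false false true false false
    have g7 := hx1 false false false true false
    have g8 := hx0 false false false true false
    have g9 := hx1 false false false false true
    have g10 := hx0 false false false false true
    have h01 : ∀ {n : ℤ}, n ≤ 1 → 0 ≤ n → n = 0 ∨ n = 1 := by omega
    rcases h01 f1 f2 with h | h <;> rcases h01 f7 f8 with h' | h' <;>
      rcases h01 f3 f4 with i | i <;> rcases h01 f5 f6 with j | j <;> linarith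
  have hb1 := hb true
  have hb2 := hb false
  simp only [Bool.not_true, Bool.not_false] at hb1 hb2
  have z := fun b c d e f h h' h'' => hz b c d e f h h' h''
  simp only [Bool.forall_bool, Bool.and_true, Bool.and_false, forall_const, reduceCtorEq,
    IsEmpty.forall_iff, and_true] at z
  simp only [Fintype.sum_bool, Bool.toNat_true, Bool.toNat_false, Nat.cast_one, Nat.cast_zero, z]
  have l1 := h2 false false true true false
  have l2 := h2 false false true false true
  have l3 := h3 false true true false false
  have l4 := h3 true false false false false
  have l5 := h3 false true false true true
  have l6 := h3 false false true true true
  have p1 := hx0 true true true true true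
  have p2 := hx0 true true true true false
  have p3 := hx0 true true true false true
  have p4 := hx0 true true false true true
  have p5 := hx0 true false true true true
  have p6 := hx0 false true true true true
  have p7 := hx0 true false false true true
  have p8 := hx0 true true false true false
  have p9 := hx0 true true false false true
  have p10 := hx0 true false true true false
  have p11 := hx0 true false true false true
  linarith

/-- The analogue of `disjoint_links_inequality` for two members. -/
lemma two_links_inequality (x y : Bool → Bool → Bool → Bool → ℤ)
    (hx0 : ∀ b c d e, 0 ≤ x b c d e)
    (h1 : ∀ b c d e, x b c d e ≤ y true true d e)
    (h2 : ∀ b c d e, x b c d e ≤ y b c true true)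
    (hz : ∀ b c d e, (b && c) = false → (d && e) = false → y b c d e = 0)
    (k : y true true false false ≤ y true true true true) :
    0 ≤ ∑ b, ∑ c, ∑ d, ∑ e,
      ((2 * (b.toNat + c.toNat + d.toNat + e.toNat) - 4) * x b c d e +
       (2 * (b.toNat + c.toNat + d.toNat + e.toNat) - 4) * y b c d e) := by
  have a0 := h1 false false true true
  have a1 := h1 false false true false
  have a2 := h1 false false false true
  have a3 := h2 true false false false
  have a4 := h2 false true false false
  have a5 := (h1 false false false false).trans k
  have p0 := hx0 true true true true
  have p1 := hx0 true true true false
  have p2 := hx0 true true false true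
  have p3 := hx0 true false true true
  have p4 := hx0 false true true true
  simp only [Bool.forall_bool, Bool.and_true, Bool.and_false, forall_const, reduceCtorEq,
    IsEmpty.forall_iff, and_true] at hz
  simp only [Fintype.sum_bool, Bool.toNat_true, Bool.toNat_false, Nat.cast_one, Nat.cast_zero, hz]
  linarith

section Family

variable {α : Type*} [DecidableEq α]

/-- An element is abundant in a family of finite sets if at least half of the members contain
it. -/
def Abundant (F : Finset (Finset α)) (v : α) : Prop :=
  F.card ≤ 2 * (F.filter (v ∈ ·)).card

/-- The indicator of a family of finite sets. -/
def familyInd (F : Finset (Finset α)) (T : Finset α) : ℤ := if T ∈ F then 1 else 0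

lemma familyInd_nonneg (F : Finset (Finset α)) (T : Finset α) : 0 ≤ familyInd F T := by
  unfold familyInd; split_ifs <;> simp

lemma familyInd_le_one (F : Finset (Finset α)) (T : Finset α) : familyInd F T ≤ 1 := by
  unfold familyInd; split_ifs <;> simp

lemma familyInd_add_le {F : Finset (Finset α)} (hF : ∀ S ∈ F, ∀ T ∈ F, S ∪ T ∈ F)
    (S T : Finset α) : familyInd F S + familyInd F T ≤ 1 + familyInd F (S ∪ T) := by
  have := hF S
  unfold familyInd
  split_ifs <;> simp_all

lemma familyInd_le_of_union_eq {F : Finset (Finset α)} (hF : ∀ S ∈ F, ∀ T ∈ F, S ∪ T ∈ F)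
    {A : Finset α} (hA : A ∈ F) {S T : Finset α} (h : S ∪ A = T) :
    familyInd F S ≤ familyInd F T := by
  have := familyInd_add_le hF S A
  rw [h] at this
  have hA' : familyInd F A = 1 := if_pos hA
  linarith

lemma exists_abundant_of_weights [Fintype α] {ι : Type*} [Fintype ι] (F : Finset (Finset α))
    (v : ι → α) (c : ι → ℤ) (hc : ∀ i, 0 ≤ c i) (hpos : ∃ i, 0 < c i)
    (h : 0 ≤ ∑ T ∈ (Finset.univ : Finset α).powerset,
      (∑ i, c i * (if v i ∈ T then 1 else -1)) * familyInd F T) :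
    ∃ i, Abundant F (v i) := by
  by_contra! hcon
  have key : ∀ i, ∑ T ∈ F, (if v i ∈ T then (1 : ℤ) else -1) < 0 := by
    intro i
    have h1 := hcon i
    unfold Abundant at h1
    have h2 := Finset.card_filter_add_card_filter_not (s := F) (fun T => v i ∈ T)
    rw [Finset.sum_ite, Finset.sum_const, Finset.sum_const]
    simp only [nsmul_eq_mul, mul_one, mul_neg]
    omega
  have hsum : ∑ T ∈ (Finset.univ : Finset α).powerset,
      (∑ i, c i * (if v i ∈ T then 1 else -1)) * familyInd F T
      = ∑ i, c i * ∑ T ∈ F, (if v i ∈ T then (1 : ℤ) else -1) := by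
    simp only [familyInd, mul_ite, mul_one, mul_zero, Finset.powerset_univ, ← Finset.sum_filter,
      Finset.filter_mem_eq_inter, Finset.univ_inter, Finset.mul_sum]
    exact Finset.sum_comm
  rw [hsum] at h
  obtain ⟨j, hj⟩ := hpos
  have : ∑ i, c i * ∑ T ∈ F, (if v i ∈ T then (1 : ℤ) else -1) < ∑ _i : ι, (0 : ℤ) :=
    Finset.sum_lt_sum (fun i _ => mul_nonpos_of_nonneg_of_nonpos (hc i) (key i).le)
      ⟨j, Finset.mem_univ j, mul_neg_of_pos_of_neg hj (key j)⟩
  simp at this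
  linarith

/-- Insert an element into a finite set, depending on a Boolean. -/
def insertIf (v : α) (β : Bool) (T : Finset α) : Finset α := if β then insert v T else T

lemma mem_insertIf {v a : α} {β : Bool} {T : Finset α} :
    a ∈ insertIf v β T ↔ (β = true ∧ a = v) ∨ a ∈ T := by
  cases β <;> simp [insertIf]

lemma insertIf_union (v : α) (β γ : Bool) (S T : Finset α) :
    insertIf v β S ∪ insertIf v γ T = insertIf v (β || γ) (S ∪ T) := by
  ext a
  simp only [Finset.mem_union, mem_insertIf, Bool.or_eq_true]
  tauto

lemma sum_powerset_insert_insertIf {R : Finset α} {v : α} (hv : v ∉ R) (f : Finset α → ℤ) :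
    ∑ T ∈ (insert v R).powerset, f T = ∑ T ∈ R.powerset, ∑ β, f (insertIf v β T) := by
  rw [Finset.sum_powerset_insert hv]
  simp only [Fintype.sum_bool, insertIf, if_true, Bool.false_eq_true, if_false,
    Finset.sum_add_distrib]
  rw [add_comm]

variable [Fintype α] {F : Finset (Finset α)} (hF : ∀ S ∈ F, ∀ T ∈ F, S ∪ T ∈ F)

include hF in
/-- If every member of a union-closed family that contains `w` contains one of three members of
  size three
that meet pairwise only in `w`, then one of the elements of these three members is abundant. -/
theorem exists_abundant_of_disjoint_links {w b₁ c₁ b₂ c₂ b₃ c₃ : α}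
    (hd : [w, c₃, b₃, c₂, b₂, c₁, b₁].Nodup)
    (h₁ : {w, b₁, c₁} ∈ F) (h₂ : {w, b₂, c₂} ∈ F) (h₃ : {w, b₃, c₃} ∈ F)
    (hw : ∀ T ∈ F, w ∈ T → (b₁ ∈ T ∧ c₁ ∈ T) ∨ (b₂ ∈ T ∧ c₂ ∈ T) ∨ (b₃ ∈ T ∧ c₃ ∈ T)) :
    ∃ i, Abundant F (![w, b₁, c₁, b₂, c₂, b₃, c₃] i) := by
  apply exists_abundant_of_weights F _ ![2, 3, 3, 3, 3, 3, 3] (by decide) ⟨0, by simp⟩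
  set R : Finset α := Finset.univ \ [w, c₃, b₃, c₂, b₂, c₁, b₁].toFinset with hR
  have huniv : (Finset.univ : Finset α) =
      insert w (insert c₃ (insert b₃ (insert c₂ (insert b₂ (insert c₁ (insert b₁ R)))))) := by
    ext a
    simp only [hR, Finset.mem_insert, Finset.mem_sdiff, List.mem_toFinset, List.mem_cons]
    grind
  obtain ⟨r1, r2, r3, r4, r5, r6, r7⟩ : w ∉ R ∧ c₃ ∉ R ∧ b₃ ∉ R ∧ c₂ ∉ R ∧ b₂ ∉ R ∧ c₁ ∉ R ∧ b₁ ∉ R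
    := by simp [hR]
  clear_value R
  simp only [List.nodup_cons, List.mem_cons, List.not_mem_nil, or_false, not_or,
    List.nodup_nil, not_false_eq_true, and_true] at hd
  obtain ⟨⟨n1, n2, n3, n4, n5, n6⟩, ⟨n7, n8, n9, n10, n11⟩, ⟨n12, n13, n14, n15⟩, ⟨n16, n17, n18⟩,
    ⟨n19, n20⟩, n21⟩ := hd
  rw [huniv]
  iterate 7 rw [sum_powerset_insert_insertIf (by
    simp only [Finset.mem_insert, r1, r2, r3, r4, r5, r6, r7, n1, n2, n3, n4, n5, n6, n7, n8, n9,
      n10, n11, n12, n13, n14, n15, n16, n17, n18, n19, n20, n21, or_self, not_false_eq_true])]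
  refine Finset.sum_nonneg fun T hT => ?_
  rw [Finset.mem_powerset] at hT
  replace r1 : w ∉ T := fun h => r1 (hT h)
  replace r2 : c₃ ∉ T := fun h => r2 (hT h)
  replace r3 : b₃ ∉ T := fun h => r3 (hT h)
  replace r4 : c₂ ∉ T := fun h => r4 (hT h)
  replace r5 : b₂ ∉ T := fun h => r5 (hT h)
  replace r6 : c₁ ∉ T := fun h => r6 (hT h)
  replace r7 : b₁ ∉ T := fun h => r7 (hT h)
  set E : Bool → Bool → Bool → Bool → Bool → Bool → Bool → Finset α := fun o a b c d e f =>
    insertIf w o (insertIf c₃ f (insertIf b₃ e (insertIf c₂ d (insertIf b₂ c (insertIf c₁ b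
      (insertIf b₁ a T)))))) with hE
  have hEun : ∀ o a b c d e f o' a' b' c' d' e' f', E o a b c d e f ∪ E o' a' b' c' d' e' f' =
      E (o || o') (a || a') (b || b') (c || c') (d || d') (e || e') (f || f') := by
    intros; simp only [hE, insertIf_union, Finset.union_self]
  have hE₁ : ∀ o a b c d e f, E o a b c d e f ∪ {w, b₁, c₁} = E true true true c d e f := by
    intros
    have : ({w, b₁, c₁} : Finset α) =
        insertIf w true (insertIf c₃ false (insertIf b₃ false (insertIf c₂ false (insertIf b₂ false
          (insertIf c₁ true (insertIf b₁ true ∅)))))) := by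
      simp [insertIf, Finset.pair_comm]
    simp only [this, hE, insertIf_union, Finset.union_empty, Bool.or_true, Bool.or_false]
  have hE₂ : ∀ o a b c d e f, E o a b c d e f ∪ {w, b₂, c₂} = E true a b true true e f := by
    intros
    have : ({w, b₂, c₂} : Finset α) =
        insertIf w true (insertIf c₃ false (insertIf b₃ false (insertIf c₂ true (insertIf b₂ true
          (insertIf c₁ false (insertIf b₁ false ∅)))))) := by
      simp [insertIf, Finset.pair_comm]
    simp only [this, hE, insertIf_union, Finset.union_empty, Bool.or_true, Bool.or_false]
  have hE₃ : ∀ o a b c d e f, E o a b c d e f ∪ {w, b₃, c₃} = E true a b c d true true := by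
    intros
    have : ({w, b₃, c₃} : Finset α) =
        insertIf w true (insertIf c₃ true (insertIf b₃ true (insertIf c₂ false (insertIf b₂ false
          (insertIf c₁ false (insertIf b₁ false ∅)))))) := by
      simp [insertIf, Finset.pair_comm]
    simp only [this, hE, insertIf_union, Finset.union_empty, Bool.or_true, Bool.or_false]
  have hEm : ∀ o a b c d e f, (w ∈ E o a b c d e f ↔ o = true) ∧ (b₁ ∈ E o a b c d e f ↔ a = true)
    ∧ (c₁ ∈ E o a b c d e f ↔ b = true) ∧ (b₂ ∈ E o a b c d e f ↔ c = true) ∧ (c₂ ∈ E o a b c d e f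
    ↔ d = true) ∧ (b₃ ∈ E o a b c d e f ↔ e = true) ∧ (c₃ ∈ E o a b c d e f ↔ f = true) := by
    intros
    simp only [hE, mem_insertIf, r1, r2, r3, r4, r5, r6, r7, n1, n2, n3, n4, n5, n6, n7, n8, n9,
      n10, n11, n12, n13, n14, n15, n16, n17, n18, n19, n20, n21, Ne.symm n1, Ne.symm n2, Ne.symm
      n3, Ne.symm n4, Ne.symm n5, Ne.symm n6, Ne.symm n7, Ne.symm n8, Ne.symm n9, Ne.symm n10,
      Ne.symm n11, Ne.symm n12, Ne.symm n13, Ne.symm n14, Ne.symm n15, Ne.symm n16, Ne.symm n17,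
      Ne.symm n18, Ne.symm n19, Ne.symm n20, Ne.symm n21, and_true, and_false, or_false, false_or,
      and_self]
  have key := disjoint_links_inequality (fun a b c d e f => familyInd F (E false a b c d e f))
    (fun a b c d e f => familyInd F (E true a b c d e f))
    (fun _ _ _ _ _ _ => familyInd_nonneg _ _)
    (fun _ _ _ _ _ _ => familyInd_le_one _ _)
    (fun _ _ _ _ _ _ => familyInd_le_one _ _)
    (fun a b c d e f a' b' c' d' e' f' => (familyInd_add_le hF _ _).trans_eq
      (by rw [hEun]; rfl))
    (fun _ _ _ _ _ _ => familyInd_le_of_union_eq hF h₁ (hE₁ _ _ _ _ _ _ _))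
    (fun _ _ _ _ _ _ => familyInd_le_of_union_eq hF h₂ (hE₂ _ _ _ _ _ _ _))
    (fun _ _ _ _ _ _ => familyInd_le_of_union_eq hF h₃ (hE₃ _ _ _ _ _ _ _))
    (fun _ _ _ _ _ _ => familyInd_le_of_union_eq hF h₁ (hE₁ _ _ _ _ _ _ _))
    (fun _ _ _ _ _ _ => familyInd_le_of_union_eq hF h₂ (hE₂ _ _ _ _ _ _ _))
    (fun _ _ _ _ _ _ => familyInd_le_of_union_eq hF h₃ (hE₃ _ _ _ _ _ _ _))
    (fun a b c d e f g₁ g₂ g₃ => if_neg fun hmem => by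
      obtain ⟨e1, e2, e3, e4, e5, e6, e7⟩ := hEm true a b c d e f
      have hlink := hw _ hmem (e1.2 rfl)
      rw [e2, e3, e4, e5, e6, e7] at hlink
      rw [← Bool.not_eq_true, Bool.and_eq_true] at g₁ g₂ g₃
      rcases hlink with h | h | h
      exacts [g₁ h, g₂ h, g₃ h])
  beta_reduce at key
  refine (mul_nonneg zero_le_two key).trans_eq ?_
  simp only [Finset.mul_sum]
  refine Finset.sum_congr rfl fun a _ => Finset.sum_congr rfl fun b _ =>
    Finset.sum_congr rfl fun c _ => Finset.sum_congr rfl fun d _ => Finset.sum_congr rfl fun e _ =>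
    Finset.sum_congr rfl fun f _ => ?_
  rw [Fintype.sum_bool]
  have hcoef : ∀ o, (∑ i, (![2, 3, 3, 3, 3, 3, 3] : Fin 7 → ℤ) i *
      (if ![w, b₁, c₁, b₂, c₂, b₃, c₃] i ∈ E o a b c d e f then 1 else -1)) =
      2 * (2 * o.toNat + 3 * (a.toNat + b.toNat + c.toNat + d.toNat + e.toNat + f.toNat) - 10) := by
    intro o
    obtain ⟨e1, e2, e3, e4, e5, e6, e7⟩ := hEm o a b c d e f
    have hb : ∀ (k : ℤ) (β : Bool), (if β = true then k else -k) = k * (2 * β.toNat - 1) := by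
      intro k β; cases β <;> simp
    simp [Fin.sum_univ_succ, e1, e2, e3, e4, e5, e6, e7, hb]
    ring
  rw [hcoef true, hcoef false]
  simp only [Bool.toNat_true, Bool.toNat_false, Nat.cast_one, Nat.cast_zero]
  ring

include hF in
/-- The analogue of `exists_abundant_of_disjoint_links` where two of the three members share
a second element. -/
theorem exists_abundant_of_path_links {w u p q r s : α}
    (hd : [w, s, r, q, p, u].Nodup)
    (h₁ : {w, u, p} ∈ F) (h₂ : {w, u, q} ∈ F) (h₃ : {w, r, s} ∈ F)
    (hw : ∀ T ∈ F, w ∈ T → (u ∈ T ∧ p ∈ T) ∨ (u ∈ T ∧ q ∈ T) ∨ (r ∈ T ∧ s ∈ T)) :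
    ∃ i, Abundant F (![w, u, p, q, r, s] i) := by
  apply exists_abundant_of_weights F _ ![1, 2, 1, 1, 1, 1] (by decide) ⟨0, by simp⟩
  set R : Finset α := Finset.univ \ [w, s, r, q, p, u].toFinset with hR
  have huniv : (Finset.univ : Finset α) =
      insert w (insert s (insert r (insert q (insert p (insert u R))))) := by
    ext a
    simp only [hR, Finset.mem_insert, Finset.mem_sdiff, List.mem_toFinset, List.mem_cons]
    grind
  obtain ⟨r1, r2, r3, r4, r5, r6⟩ : w ∉ R ∧ s ∉ R ∧ r ∉ R ∧ q ∉ R ∧ p ∉ R ∧ u ∉ R := by simp [hR]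
  clear_value R
  simp only [List.nodup_cons, List.mem_cons, List.not_mem_nil, or_false, not_or,
    List.nodup_nil, not_false_eq_true, and_true] at hd
  obtain ⟨⟨n1, n2, n3, n4, n5⟩, ⟨n6, n7, n8, n9⟩, ⟨n10, n11, n12⟩, ⟨n13, n14⟩, n15⟩ := hd
  rw [huniv]
  iterate 6 rw [sum_powerset_insert_insertIf (by
    simp only [Finset.mem_insert, r1, r2, r3, r4, r5, r6, n1, n2, n3, n4, n5, n6, n7, n8, n9, n10,
      n11, n12, n13, n14, n15, or_self, not_false_eq_true])]
  refine Finset.sum_nonneg fun T hT => ?_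
  rw [Finset.mem_powerset] at hT
  replace r1 : w ∉ T := fun h => r1 (hT h)
  replace r2 : s ∉ T := fun h => r2 (hT h)
  replace r3 : r ∉ T := fun h => r3 (hT h)
  replace r4 : q ∉ T := fun h => r4 (hT h)
  replace r5 : p ∉ T := fun h => r5 (hT h)
  replace r6 : u ∉ T := fun h => r6 (hT h)
  set E : Bool → Bool → Bool → Bool → Bool → Bool → Finset α := fun o b c d e f =>
    insertIf w o (insertIf s f (insertIf r e (insertIf q d (insertIf p c (insertIf u b T))))) with
      hE
  have hEun : ∀ o b c d e f o' b' c' d' e' f', E o b c d e f ∪ E o' b' c' d' e' f' =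
      E (o || o') (b || b') (c || c') (d || d') (e || e') (f || f') := by
    intros; simp only [hE, insertIf_union, Finset.union_self]
  have hE₁ : ∀ o b c d e f, E o b c d e f ∪ {w, u, p} = E true true true d e f := by
    intros
    have : ({w, u, p} : Finset α) =
        insertIf w true (insertIf s false (insertIf r false (insertIf q false (insertIf p true
          (insertIf u true ∅))))) := by
      simp [insertIf, Finset.pair_comm]
    simp only [this, hE, insertIf_union, Finset.union_empty, Bool.or_true, Bool.or_false]
  have hE₂ : ∀ o b c d e f, E o b c d e f ∪ {w, u, q} = E true true c true e f := by
    intros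
    have : ({w, u, q} : Finset α) =
        insertIf w true (insertIf s false (insertIf r false (insertIf q true (insertIf p false
          (insertIf u true ∅))))) := by
      simp [insertIf, Finset.pair_comm]
    simp only [this, hE, insertIf_union, Finset.union_empty, Bool.or_true, Bool.or_false]
  have hE₃ : ∀ o b c d e f, E o b c d e f ∪ {w, r, s} = E true b c d true true := by
    intros
    have : ({w, r, s} : Finset α) =
        insertIf w true (insertIf s true (insertIf r true (insertIf q false (insertIf p false
          (insertIf u false ∅))))) := by
      simp [insertIf, Finset.pair_comm]
    simp only [this, hE, insertIf_union, Finset.union_empty, Bool.or_true, Bool.or_false]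
  have hEm : ∀ o b c d e f, (w ∈ E o b c d e f ↔ o = true) ∧ (u ∈ E o b c d e f ↔ b = true) ∧ (p ∈
    E o b c d e f ↔ c = true) ∧ (q ∈ E o b c d e f ↔ d = true) ∧ (r ∈ E o b c d e f ↔ e = true) ∧
    (s ∈ E o b c d e f ↔ f = true) := by
    intros
    simp only [hE, mem_insertIf, r1, r2, r3, r4, r5, r6, n1, n2, n3, n4, n5, n6, n7, n8, n9, n10,
      n11, n12, n13, n14, n15, Ne.symm n1, Ne.symm n2, Ne.symm n3, Ne.symm n4, Ne.symm n5, Ne.symm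
      n6, Ne.symm n7, Ne.symm n8, Ne.symm n9, Ne.symm n10, Ne.symm n11, Ne.symm n12, Ne.symm n13,
      Ne.symm n14, Ne.symm n15, and_true, and_false, or_false, false_or, and_self]
  have key := path_links_inequality (fun b c d e f => familyInd F (E false b c d e f))
    (fun b c d e f => familyInd F (E true b c d e f))
    (fun _ _ _ _ _ => familyInd_nonneg _ _)
    (fun _ _ _ _ _ => familyInd_le_one _ _)
    (fun _ _ _ _ _ => familyInd_nonneg _ _)
    (fun _ _ _ _ _ => familyInd_le_one _ _)
    (fun b c d e f b' c' d' e' f' => (familyInd_add_le hF _ _).trans_eq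
      (by rw [hEun]; rfl))
    (fun _ _ _ _ _ => familyInd_le_of_union_eq hF h₁ (hE₁ _ _ _ _ _ _))
    (fun _ _ _ _ _ => familyInd_le_of_union_eq hF h₂ (hE₂ _ _ _ _ _ _))
    (fun _ _ _ _ _ => familyInd_le_of_union_eq hF h₃ (hE₃ _ _ _ _ _ _))
    (fun _ _ _ _ _ => familyInd_le_of_union_eq hF h₁ (hE₁ _ _ _ _ _ _))
    (fun _ _ _ _ _ => familyInd_le_of_union_eq hF h₂ (hE₂ _ _ _ _ _ _))
    (fun _ _ _ _ _ => familyInd_le_of_union_eq hF h₃ (hE₃ _ _ _ _ _ _))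
    (fun b c d e f g₁ g₂ g₃ => if_neg fun hmem => by
      obtain ⟨e1, e2, e3, e4, e5, e6⟩ := hEm true b c d e f
      have hlink := hw _ hmem (e1.2 rfl)
      rw [e2, e3, e4, e5, e6] at hlink
      rw [← Bool.not_eq_true, Bool.and_eq_true] at g₁ g₂ g₃
      rcases hlink with h | h | h
      exacts [g₁ h, g₂ h, g₃ h])
  beta_reduce at key
  refine key.trans_eq ?_
  refine Finset.sum_congr rfl fun b _ => Finset.sum_congr rfl fun c _ =>
    Finset.sum_congr rfl fun d _ => Finset.sum_congr rfl fun e _ => Finset.sum_congr rfl fun f _ => ?_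
  rw [Fintype.sum_bool]
  have hcoef : ∀ o, (∑ i, (![1, 2, 1, 1, 1, 1] : Fin 6 → ℤ) i *
      (if ![w, u, p, q, r, s] i ∈ E o b c d e f then 1 else -1)) =
      2 * (o.toNat + 2 * b.toNat + c.toNat + d.toNat + e.toNat + f.toNat) - 7 := by
    intro o
    obtain ⟨e1, e2, e3, e4, e5, e6⟩ := hEm o b c d e f
    have hb : ∀ (k : ℤ) (β : Bool), (if β = true then k else -k) = k * (2 * β.toNat - 1) := by
      intro k β; cases β <;> simp
    simp [Fin.sum_univ_succ, e1, e2, e3, e4, e5, e6, hb]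
    ring
  rw [hcoef true, hcoef false]
  simp only [Bool.toNat_true, Bool.toNat_false, Nat.cast_one, Nat.cast_zero]
  ring

include hF in
/-- The analogue of `exists_abundant_of_disjoint_links` with two members instead of three. -/
theorem exists_abundant_of_two_links {w b₁ c₁ b₂ c₂ : α}
    (hd : [w, c₂, b₂, c₁, b₁].Nodup)
    (h₁ : {w, b₁, c₁} ∈ F) (h₂ : {w, b₂, c₂} ∈ F)
    (hw : ∀ T ∈ F, w ∈ T → (b₁ ∈ T ∧ c₁ ∈ T) ∨ (b₂ ∈ T ∧ c₂ ∈ T)) :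
    ∃ i, Abundant F (![w, b₁, c₁, b₂, c₂] i) := by
  apply exists_abundant_of_weights F _ ![0, 1, 1, 1, 1] (by decide) ⟨1, by simp⟩
  set R : Finset α := Finset.univ \ [w, c₂, b₂, c₁, b₁].toFinset with hR
  have huniv : (Finset.univ : Finset α) =
      insert w (insert c₂ (insert b₂ (insert c₁ (insert b₁ R)))) := by
    ext a
    simp only [hR, Finset.mem_insert, Finset.mem_sdiff, List.mem_toFinset, List.mem_cons]
    grind
  obtain ⟨r1, r2, r3, r4, r5⟩ : w ∉ R ∧ c₂ ∉ R ∧ b₂ ∉ R ∧ c₁ ∉ R ∧ b₁ ∉ R := by simp [hR]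
  clear_value R
  simp only [List.nodup_cons, List.mem_cons, List.not_mem_nil, or_false, not_or,
    List.nodup_nil, not_false_eq_true, and_true] at hd
  obtain ⟨⟨n1, n2, n3, n4⟩, ⟨n5, n6, n7⟩, ⟨n8, n9⟩, n10⟩ := hd
  rw [huniv]
  iterate 5 rw [sum_powerset_insert_insertIf (by
    simp only [Finset.mem_insert, r1, r2, r3, r4, r5, n1, n2, n3, n4, n5, n6, n7, n8, n9, n10,
      or_self, not_false_eq_true])]
  refine Finset.sum_nonneg fun T hT => ?_
  rw [Finset.mem_powerset] at hT
  replace r1 : w ∉ T := fun h => r1 (hT h)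
  replace r2 : c₂ ∉ T := fun h => r2 (hT h)
  replace r3 : b₂ ∉ T := fun h => r3 (hT h)
  replace r4 : c₁ ∉ T := fun h => r4 (hT h)
  replace r5 : b₁ ∉ T := fun h => r5 (hT h)
  set E : Bool → Bool → Bool → Bool → Bool → Finset α := fun o b c d e =>
    insertIf w o (insertIf c₂ e (insertIf b₂ d (insertIf c₁ c (insertIf b₁ b T)))) with hE
  have hEun : ∀ o b c d e o' b' c' d' e', E o b c d e ∪ E o' b' c' d' e' =
      E (o || o') (b || b') (c || c') (d || d') (e || e') := by
    intros; simp only [hE, insertIf_union, Finset.union_self]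
  have hE₁ : ∀ o b c d e, E o b c d e ∪ {w, b₁, c₁} = E true true true d e := by
    intros
    have : ({w, b₁, c₁} : Finset α) =
        insertIf w true (insertIf c₂ false (insertIf b₂ false (insertIf c₁ true (insertIf b₁ true
          ∅)))) := by
      simp [insertIf, Finset.pair_comm]
    simp only [this, hE, insertIf_union, Finset.union_empty, Bool.or_true, Bool.or_false]
  have hE₂ : ∀ o b c d e, E o b c d e ∪ {w, b₂, c₂} = E true b c true true := by
    intros
    have : ({w, b₂, c₂} : Finset α) =
        insertIf w true (insertIf c₂ true (insertIf b₂ true (insertIf c₁ false (insertIf b₁ false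
          ∅)))) := by
      simp [insertIf, Finset.pair_comm]
    simp only [this, hE, insertIf_union, Finset.union_empty, Bool.or_true, Bool.or_false]
  have hEm : ∀ o b c d e, (w ∈ E o b c d e ↔ o = true) ∧ (b₁ ∈ E o b c d e ↔ b = true) ∧ (c₁ ∈ E o
    b c d e ↔ c = true) ∧ (b₂ ∈ E o b c d e ↔ d = true) ∧ (c₂ ∈ E o b c d e ↔ e = true) := by
    intros
    simp only [hE, mem_insertIf, r1, r2, r3, r4, r5, n1, n2, n3, n4, n5, n6, n7, n8, n9, n10,
      Ne.symm n1, Ne.symm n2, Ne.symm n3, Ne.symm n4, Ne.symm n5, Ne.symm n6, Ne.symm n7, Ne.symm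
      n8, Ne.symm n9, Ne.symm n10, and_true, and_false, or_false, false_or, and_self]
  have key := two_links_inequality (fun b c d e => familyInd F (E false b c d e))
    (fun b c d e => familyInd F (E true b c d e))
    (fun _ _ _ _ => familyInd_nonneg _ _)
    (fun _ _ _ _ => familyInd_le_of_union_eq hF h₁ (hE₁ _ _ _ _ _))
    (fun _ _ _ _ => familyInd_le_of_union_eq hF h₂ (hE₂ _ _ _ _ _))
    (fun b c d e g₁ g₂ => if_neg fun hmem => by
      obtain ⟨e1, e2, e3, e4, e5⟩ := hEm true b c d e
      have hlink := hw _ hmem (e1.2 rfl)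
      rw [e2, e3, e4, e5] at hlink
      rw [← Bool.not_eq_true, Bool.and_eq_true] at g₁ g₂
      rcases hlink with h | h
      exacts [g₁ h, g₂ h])
    (familyInd_le_of_union_eq hF h₂ (hE₂ _ _ _ _ _))
  beta_reduce at key
  refine key.trans_eq ?_
  refine Finset.sum_congr rfl fun b _ => Finset.sum_congr rfl fun c _ =>
    Finset.sum_congr rfl fun d _ => Finset.sum_congr rfl fun e _ => ?_
  rw [Fintype.sum_bool]
  have hcoef : ∀ o, (∑ i, (![0, 1, 1, 1, 1] : Fin 5 → ℤ) i *
      (if ![w, b₁, c₁, b₂, c₂] i ∈ E o b c d e then 1 else -1)) =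
      2 * (b.toNat + c.toNat + d.toNat + e.toNat) - 4 := by
    intro o
    obtain ⟨e1, e2, e3, e4, e5⟩ := hEm o b c d e
    have hb : ∀ (k : ℤ) (β : Bool), (if β = true then k else -k) = k * (2 * β.toNat - 1) := by
      intro k β; cases β <;> simp
    simp [Fin.sum_univ_succ, e1, e2, e3, e4, e5, hb]
    ring
  rw [hcoef true, hcoef false]
  ring

omit [Fintype α] in
include hF in
/-- If every member of a union-closed family that avoids two elements `b`, `c` of a member `e`
is disjoint from `e`, then `b` or `c` is abundant. -/
lemma abundant_or_abundant_of_disjoint {e : Finset α} (he : e ∈ F) {b c : α} (hb : b ∈ e)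
    (hc : c ∈ e) (h : ∀ T ∈ F, b ∉ T → c ∉ T → Disjoint T e) : Abundant F b ∨ Abundant F c := by
  have hinj : (F.filter fun T => b ∉ T ∧ c ∉ T).card ≤
      (F.filter (b ∈ ·) ∩ F.filter (c ∈ ·)).card := by
    refine Finset.card_le_card_of_injOn (· ∪ e) ?_ ?_
    · intro T hT
      simp only [Finset.coe_filter, Set.mem_ofPred_eq] at hT
      simp [hF T hT.1 e he, hb, hc]
    · intro S hS T hT hST
      simp only [Finset.coe_filter, Set.mem_ofPred_eq] at hS hT
      rw [← Finset.union_sdiff_cancel_right (h S hS.1 hS.2.1 hS.2.2),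
        ← Finset.union_sdiff_cancel_right (h T hT.1 hT.2.1 hT.2.2)]
      exact congrArg (· \ e) hST
  have hU := Finset.card_union_add_card_inter (F.filter (b ∈ ·)) (F.filter (c ∈ ·))
  have hN := Finset.card_filter_add_card_filter_not (s := F) (fun T => b ∈ T ∨ c ∈ T)
  rw [Finset.filter_or] at hN
  simp only [not_or] at hN
  unfold Abundant
  omega

omit [Fintype α] in
lemma exists_eq_triple {s : Finset α} (hs : s.card = 3) {w u : α} (hw : w ∈ s) (hu : u ∈ s)
    (hwu : w ≠ u) : ∃ p, s = {w, u, p} ∧ w ≠ p ∧ u ≠ p := by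
  have h1 : ((s.erase w).erase u).card = 1 := by
    rw [Finset.card_erase_of_mem (Finset.mem_erase.2 ⟨hwu.symm, hu⟩), Finset.card_erase_of_mem hw,
      hs]
  obtain ⟨p, hp⟩ := Finset.card_eq_one.1 h1
  have hp' : p ∈ (s.erase w).erase u := by simp [hp]
  simp only [Finset.mem_erase, ne_eq] at hp'
  refine ⟨p, ?_, fun h => hp'.2.1 h.symm, fun h => hp'.1 h.symm⟩
  rw [← hp, Finset.insert_erase (Finset.mem_erase.2 ⟨hwu.symm, hu⟩), Finset.insert_erase hw]

omit [Fintype α] in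
lemma exists_eq_triple_of_mem {s : Finset α} (hs : s.card = 3) {w : α} (hw : w ∈ s) :
    ∃ u p, s = {w, u, p} ∧ w ≠ u ∧ w ≠ p ∧ u ≠ p := by
  obtain ⟨u, hu, hne⟩ := Finset.exists_mem_ne (by omega : 1 < s.card) w
  obtain ⟨p, h1, h2, h3⟩ := exists_eq_triple hs hw hu hne.symm
  exact ⟨u, p, h1, hne.symm, h2, h3⟩

include hF in
/-- Three members of size three through `w`, one of which meets the other two only in `w`. -/
lemma exists_abundant_of_three_links {w : α} {x y z : Finset α} (hx : x ∈ F) (hy : y ∈ F)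
    (hz : z ∈ F) (hx3 : x.card = 3) (hy3 : y.card = 3) (hz3 : z.card = 3) (hxy : x ≠ y)
    (hwx : w ∈ x) (hwy : w ∈ y) (hwz : w ∈ z) (hxz : ∀ a ∈ x, a ∈ z → a = w)
    (hyz : ∀ a ∈ y, a ∈ z → a = w)
    (hw : ∀ T ∈ F, w ∈ T → x ⊆ T ∨ y ⊆ T ∨ z ⊆ T) :
    ∃ v ∈ x ∪ y ∪ z, Abundant F v := by
  obtain ⟨r, s, rfl, z1, z2, z3⟩ := exists_eq_triple_of_mem hz3 hwz
  by_cases hd : ∀ a ∈ x, a ∈ y → a = w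
  · obtain ⟨b, c, rfl, x1, x2, x3⟩ := exists_eq_triple_of_mem hx3 hwx
    obtain ⟨d, e, rfl, y1, y2, y3⟩ := exists_eq_triple_of_mem hy3 hwy
    obtain ⟨i, hi⟩ := exists_abundant_of_disjoint_links hF (w := w) (b₁ := b) (c₁ := c) (b₂ := d)
      (c₂ := e) (b₃ := r) (c₃ := s) (by simp at *; grind) hx hy hz
      (fun T hT hwT => by have := hw T hT hwT; simp only [Finset.insert_subset_iff,
        Finset.singleton_subset_iff] at this; tauto)
    exact ⟨_, by fin_cases i <;> simp, hi⟩
  · push Not at hd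
    obtain ⟨u, hux, huy, huw⟩ := hd
    obtain ⟨p, rfl, p1, p2⟩ := exists_eq_triple hx3 hwx hux huw.symm
    obtain ⟨q, rfl, q1, q2⟩ := exists_eq_triple hy3 hwy huy huw.symm
    have hpq : p ≠ q := fun h => hxy (by rw [h])
    obtain ⟨i, hi⟩ := exists_abundant_of_path_links hF (w := w) (u := u) (p := p) (q := q)
      (r := r) (s := s) (by simp at *; grind) hx hy hz
      (fun T hT hwT => by have := hw T hT hwT; simp only [Finset.insert_subset_iff,
        Finset.singleton_subset_iff] at this; tauto)
    exact ⟨_, by fin_cases i <;> simp, hi⟩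

include hF in
/-- A union-closed family generated by sets of size at most three, such that every element lies
in at most three generators, has an abundant element. -/
theorem exists_abundant_of_subcubic_generators {E : Finset (Finset α)} (hEF : E ⊆ F)
    (hgen : ∀ T ∈ F, ∀ w ∈ T, ∃ e ∈ E, w ∈ e ∧ e ⊆ T) (hE3 : ∀ e ∈ E, e.card ≤ 3)
    (hdeg : ∀ w, (E.filter (w ∈ ·)).card ≤ 3) (hne : ∃ e ∈ E, e.Nonempty) :
    ∃ e ∈ E, ∃ v ∈ e, Abundant F v := by
  by_contra! hno
  have hpair : ∀ e ∈ E, ∀ b ∈ e, ∀ c ∈ e, ∃ T ∈ F, b ∉ T ∧ c ∉ T ∧ ¬ Disjoint T e := by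
    intro e he b hb c hc
    by_contra! h
    rcases abundant_or_abundant_of_disjoint hF (hEF he) hb hc h with h' | h'
    exacts [hno e he b hb h', hno e he c hc h']
  have hcard : ∀ e ∈ E, ∀ w ∈ e, e.card = 3 := by
    intro e he w hw
    have h3 := hE3 e he
    have h0 := Finset.card_pos.2 ⟨w, hw⟩
    by_contra hcon
    obtain ⟨b, hb, hbe⟩ : ∃ b ∈ e, e = {w, b} := by
      by_cases h1 : e.card = 1
      · obtain ⟨a, rfl⟩ := Finset.card_eq_one.1 h1
        exact ⟨a, by simp, by simp_all⟩
      · obtain ⟨b, c, -, rfl⟩ := Finset.card_eq_two.1 (by omega : e.card = 2)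
        simp only [Finset.mem_insert, Finset.mem_singleton] at hw
        rcases hw with rfl | rfl
        · exact ⟨c, by simp, rfl⟩
        · exact ⟨b, by simp, Finset.pair_comm _ _⟩
    obtain ⟨T, -, h1, h2, h⟩ := hpair e he w hw b hb
    simp [hbe, h1, h2] at h
  have hpart : ∀ e ∈ E, ∀ w ∈ e, ∃ e' ∈ E, w ∈ e' ∧ ∀ a ∈ e, a ∈ e' → a = w := by
    intro e he w hw
    obtain ⟨b, c, rfl, -⟩ := exists_eq_triple_of_mem (hcard e he w hw) hw
    obtain ⟨T, hT, h1, h2, h⟩ := hpair _ he b (by simp) c (by simp)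
    have hwT : w ∈ T := by simpa [h1, h2] using h
    obtain ⟨e', he', hwe', hsub⟩ := hgen T hT w hwT
    refine ⟨e', he', hwe', fun a ha ha' => ?_⟩
    have := hsub ha'
    simp only [Finset.mem_insert, Finset.mem_singleton] at ha
    grind
  obtain ⟨x, hx, w, hwx⟩ := hne
  obtain ⟨y, hy, hwy, hxy⟩ := hpart x hx w hwx
  have hx3 := hcard x hx w hwx
  have hy3 := hcard y hy w hwy
  have hne : x ≠ y := by
    rintro rfl
    obtain ⟨u, hu, huw⟩ := Finset.exists_mem_ne (by omega : 1 < x.card) w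
    exact huw (hxy u hu hu)
  by_cases hz : ∃ z ∈ E, w ∈ z ∧ z ≠ x ∧ z ≠ y
  · obtain ⟨z, hz, hwz, hzx, hzy⟩ := hz
    have hz3 := hcard z hz w hwz
    have heq : ({x, y, z} : Finset (Finset α)) = E.filter (w ∈ ·) := by
      refine Finset.eq_of_subset_of_card_le ?_ ?_
      · intro e he
        simp only [Finset.mem_insert, Finset.mem_singleton] at he
        rcases he with rfl | rfl | rfl <;> simp [*]
      · rw [Finset.card_eq_three.2 ⟨x, y, z, hne, hzx.symm, hzy.symm, rfl⟩]
        exact hdeg w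
    have hcov : ∀ e ∈ E, w ∈ e → e = x ∨ e = y ∨ e = z := by
      intro e he hwe
      have : e ∈ ({x, y, z} : Finset (Finset α)) := by rw [heq]; simp [he, hwe]
      simpa using this
    have hw : ∀ T ∈ F, w ∈ T → x ⊆ T ∨ y ⊆ T ∨ z ⊆ T := by
      intro T hT hwT
      obtain ⟨e, he, hwe, hs⟩ := hgen T hT w hwT
      rcases hcov e he hwe with rfl | rfl | rfl <;> simp [hs]
    obtain ⟨v, hv, hav⟩ : ∃ v ∈ x ∪ y ∪ z, Abundant F v := by
      obtain ⟨e, he, hwe, hze⟩ := hpart z hz w hwz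
      rcases hcov e he hwe with rfl | rfl | h
      · have := exists_abundant_of_three_links hF (hEF hy) (hEF hz) (hEF hx) hy3 hz3 hx3 hzy.symm
          hwy hwz hwx (fun a h1 h2 => hxy a h2 h1) hze (fun T hT h => by grind [hw T hT h])
        grind
      · have := exists_abundant_of_three_links hF (hEF hx) (hEF hz) (hEF hy) hx3 hz3 hy3 hzx.symm
          hwx hwz hwy hxy hze (fun T hT h => by grind [hw T hT h])
        grind
      · obtain ⟨u, hu, huw⟩ := Finset.exists_mem_ne (by omega : 1 < z.card) w
        exact absurd (hze u hu (h ▸ hu)) huw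
    simp only [Finset.mem_union] at hv
    rcases hv with (hv | hv) | hv
    exacts [hno x hx v hv hav, hno y hy v hv hav, hno z hz v hv hav]
  · push Not at hz
    have hw : ∀ T ∈ F, w ∈ T → x ⊆ T ∨ y ⊆ T := by
      intro T hT hwT
      obtain ⟨e, he, hwe, hs⟩ := hgen T hT w hwT
      by_cases hex : e = x
      · exact Or.inl (hex ▸ hs)
      · exact Or.inr (hz e he hwe hex ▸ hs)
    obtain ⟨b, c, rfl, x1, x2, x3⟩ := exists_eq_triple_of_mem hx3 hwx
    obtain ⟨d, e, rfl, y1, y2, y3⟩ := exists_eq_triple_of_mem hy3 hwy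
    obtain ⟨i, hi⟩ := exists_abundant_of_two_links hF (w := w) (b₁ := b) (c₁ := c) (b₂ := d)
      (c₂ := e) (by simp at hxy ⊢; grind) (hEF hx) (hEF hy)
      (fun T hT hwT => by have := hw T hT hwT; simp only [Finset.insert_subset_iff,
        Finset.singleton_subset_iff] at this; tauto)
    fin_cases i
    exacts [hno _ hx _ (by simp) hi, hno _ hx _ (by simp) hi, hno _ hx _ (by simp) hi,
      hno _ hy _ (by simp) hi, hno _ hy _ (by simp) hi]

end Family

/-- In a bipartite graph with classes `U` and `W`, the complements in `W` of the maximal stable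
sets are the neighbourhoods of the subsets of `U`. -/
lemma mem_MSS_iff_of_isBipartition {V : Type*} {G : SimpleGraph V} {U W : Set V}
    (hb : IsBipartition G U W) (S : Set V) :
    S ∈ MSS G ↔ S ∩ U = {u ∈ U | G.neighborSet u ⊆ W \ S} ∧ W \ S = NSet G (S ∩ U) := by
  obtain ⟨hUW, hdisj, hU, hW⟩ := hb
  have hcover : ∀ v, v ∈ U ∨ v ∈ W := fun v => by
    have : v ∈ U ∪ W := hUW ▸ Set.mem_univ v
    exact this
  have hnb : ∀ u ∈ U, ∀ v, G.Adj u v → v ∈ W := fun u hu v h =>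
    (hcover v).resolve_left fun hv => hU hu hv h
  have hnb' : ∀ u ∈ W, ∀ v, G.Adj u v → v ∈ U := fun u hu v h =>
    (hcover v).resolve_right fun hv => hW hu hv h
  constructor
  · rintro ⟨hS, hmax⟩
    refine ⟨?_, ?_⟩
    · ext u
      refine ⟨fun hu => ⟨hu.2, fun v hv => ⟨hnb u hu.2 v hv, fun hvS => hS hu.1 hvS hv⟩⟩,
        fun hu => ⟨?_, hu.1⟩⟩
      by_contra huS
      obtain ⟨v, hv, h⟩ := hmax u huS
      exact (hu.2 h).2 hv
    · ext v
      refine ⟨fun hv => ?_, ?_⟩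
      · obtain ⟨u, hu, h⟩ := hmax v hv.2
        exact ⟨u, ⟨hu, hnb' v hv.1 u h⟩, h⟩
      · rintro ⟨u, hu, h⟩
        exact ⟨hnb u hu.2 v h.symm, fun hv => hS hv hu.1 h⟩
  · rintro ⟨h1, h2⟩
    have hU' : ∀ u ∈ U, u ∈ S ↔ G.neighborSet u ⊆ W \ S := fun u hu => by
      have := Set.ext_iff.1 h1 u
      simpa [hu] using this
    refine ⟨fun u hu v hv h => ?_, fun v hv => ?_⟩
    · rcases hcover u with hu' | hu'
      · exact ((hU' u hu').1 hu h).2 hv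
      · exact ((hU' v (hnb' u hu' v h)).1 hv h.symm).2 hu
    · rcases hcover v with hv' | hv'
      · rw [hU' v hv', Set.not_subset] at hv
        obtain ⟨w, hw, hwS⟩ := hv
        exact ⟨w, by_contra fun h => hwS ⟨hnb v hv' w hw, h⟩, hw⟩
      · have : v ∈ NSet G (S ∩ U) := h2 ▸ ⟨hv', hv⟩
        obtain ⟨u, hu, h⟩ := this
        exact ⟨u, hu.1, h⟩

lemma exists_mem_MSS_diff_eq {V : Type*} {G : SimpleGraph V} {U W : Set V}
    (hb : IsBipartition G U W) {A : Set V} (hA : A ⊆ U) : ∃ S ∈ MSS G, W \ S = NSet G A := by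
  have hcover : ∀ v, v ∈ U ∨ v ∈ W := fun v => by
    have : v ∈ U ∪ W := hb.1 ▸ Set.mem_univ v
    exact this
  have hdisj : ∀ v ∈ U, v ∉ W := fun v h h' => Set.disjoint_left.1 hb.2.1 h h'
  have hAW : NSet G A ⊆ W := by
    rintro v ⟨u, hu, h⟩
    exact (hcover v).resolve_left fun hv => hb.2.2.1 hv (hA hu) h
  set S : Set V := {u | u ∈ U ∧ G.neighborSet u ⊆ NSet G A} ∪ W \ NSet G A with hS
  have h1 : W \ S = NSet G A := by
    ext v
    have := hdisj v
    have := @hAW v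
    simp only [hS, Set.mem_sdiff, Set.mem_union, Set.mem_ofPred_eq]
    tauto
  have h2 : S ∩ U = {u ∈ U | G.neighborSet u ⊆ NSet G A} := by
    ext v
    have := hdisj v
    simp only [hS, Set.mem_sdiff, Set.mem_union, Set.mem_ofPred_eq, Set.mem_inter_iff]
    tauto
  refine ⟨S, (mem_MSS_iff_of_isBipartition hb S).2 ⟨by rw [h1, h2], ?_⟩, h1⟩
  rw [h1, h2]
  ext v
  constructor
  · rintro ⟨u, hu, h⟩
    exact ⟨u, ⟨hA hu, fun x hx => ⟨u, hu, G.adj_symm hx⟩⟩, h⟩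
  · rintro ⟨u, hu, h⟩
    exact hu.2 (G.adj_symm h)

theorem exists_rare_of_isBipartition {V : Type*} [Fintype V] (G : SimpleGraph V) (U W : Set V)
    (hb : IsBipartition G U W) (he : G.edgeSet.Nonempty)
    (hdeg : ∀ v, (G.neighborSet v).ncard ≤ 3) : ∃ w ∈ W, Rare G w := by
  classical
  have hcover : ∀ v, v ∈ U ∨ v ∈ W := fun v => by
    have : v ∈ U ∪ W := hb.1 ▸ Set.mem_univ v
    exact this
  have hnb : ∀ u ∈ U, ∀ v, G.Adj u v → v ∈ W := fun u hu v h =>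
    (hcover v).resolve_left fun hv => hb.2.2.1 hu hv h
  have hnb' : ∀ u ∈ W, ∀ v, G.Adj u v → v ∈ U := fun u hu v h =>
    (hcover v).resolve_right fun hv => hb.2.2.2 hu hv h
  set M : Finset (Set V) := Finset.univ.filter (· ∈ MSS G) with hM
  have hMSS : ∀ S, S ∈ M ↔ S ∈ MSS G := by simp [hM]
  set φ : Set V → Finset V := fun S => (W \ S).toFinset with hφ
  have hφm : ∀ S v, v ∈ φ S ↔ v ∈ W ∧ v ∉ S := by simp [hφ]
  set F : Finset (Finset V) := M.image φ with hF
  set E : Finset (Finset V) := U.toFinset.image (fun u => (G.neighborSet u).toFinset) with hE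
  have hE' : ∀ e, e ∈ E ↔ ∃ u ∈ U, (G.neighborSet u).toFinset = e := by simp [hE]
  have hFN : ∀ A ⊆ U, (NSet G A).toFinset ∈ F := by
    intro A hA
    obtain ⟨S, hS, h⟩ := exists_mem_MSS_diff_eq hb hA
    exact Finset.mem_image.2 ⟨S, (hMSS S).2 hS, by simp only [hφ, h]⟩
  have hNF : ∀ T ∈ F, ∃ A ⊆ U, T = (NSet G A).toFinset := by
    intro T hT
    obtain ⟨S, hS, rfl⟩ := Finset.mem_image.1 hT
    refine ⟨S ∩ U, Set.inter_subset_right, ?_⟩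
    simp only [hφ, ((mem_MSS_iff_of_isBipartition hb S).1 ((hMSS S).1 hS)).2]
  have hinj : Set.InjOn φ M := by
    intro S hS T hT h
    have hS' := (mem_MSS_iff_of_isBipartition hb S).1 ((hMSS S).1 hS)
    have hT' := (mem_MSS_iff_of_isBipartition hb T).1 ((hMSS T).1 hT)
    have hW : W \ S = W \ T := Set.toFinset_inj.1 h
    have hU : S ∩ U = T ∩ U := by rw [hS'.1, hT'.1, hW]
    ext v
    rcases hcover v with hv | hv
    · simpa [hv] using Set.ext_iff.1 hU v
    · simpa [hv, not_iff_not] using Set.ext_iff.1 hW v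
  obtain ⟨e, he, v, hv, hab⟩ := exists_abundant_of_subcubic_generators (F := F) (E := E)
    (by
      intro S hS T hT
      obtain ⟨A, hA, rfl⟩ := hNF S hS
      obtain ⟨B, hB, rfl⟩ := hNF T hT
      convert hFN (A ∪ B) (Set.union_subset hA hB)
      ext v
      rw [Finset.mem_union, Set.mem_toFinset, Set.mem_toFinset, Set.mem_toFinset]
      change (∃ u ∈ A, G.Adj v u) ∨ (∃ u ∈ B, G.Adj v u) ↔ ∃ u ∈ A ∪ B, G.Adj v u
      simp [or_and_right, exists_or])
    (by
      intro e he
      obtain ⟨u, hu, rfl⟩ := (hE' e).1 he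
      convert hFN {u} (by simpa using hu)
      ext v
      simp [NSet, G.adj_comm])
    (by
      intro T hT w hw
      obtain ⟨A, hA, rfl⟩ := hNF T hT
      obtain ⟨u, hu, h⟩ := Set.mem_toFinset.1 hw
      refine ⟨_, (hE' _).2 ⟨u, hA hu, rfl⟩, by simpa using h.symm, fun x hx => ?_⟩
      rw [Set.mem_toFinset] at hx ⊢
      exact ⟨u, hu, G.adj_symm hx⟩)
    (by
      intro e he
      obtain ⟨u, hu, rfl⟩ := (hE' e).1 he
      rw [← Set.ncard_eq_toFinset_card']
      exact hdeg u)
    (by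
      intro w
      have hsub : E.filter (w ∈ ·) ⊆
          (G.neighborSet w).toFinset.image (fun u => (G.neighborSet u).toFinset) := by
        intro e he
        obtain ⟨he, hw⟩ := Finset.mem_filter.1 he
        obtain ⟨u, hu, rfl⟩ := (hE' e).1 he
        exact Finset.mem_image.2 ⟨u, by simpa [G.adj_comm] using hw, rfl⟩
      refine (Finset.card_le_card hsub).trans (Finset.card_image_le.trans ?_)
      rw [← Set.ncard_eq_toFinset_card']
      exact hdeg w)
    (by
      obtain ⟨e, he⟩ := he
      induction e with | _ a b
      rw [SimpleGraph.mem_edgeSet] at he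
      rcases hcover a with ha | ha
      · exact ⟨_, (hE' _).2 ⟨a, ha, rfl⟩, b, by simpa using he⟩
      · exact ⟨_, (hE' _).2 ⟨b, hnb' a ha b he, rfl⟩, a, by simpa using he.symm⟩)
  obtain ⟨u, hu, rfl⟩ := (hE' e).1 he
  have hvW : v ∈ W := hnb u hu v (by simpa using hv)
  refine ⟨v, hvW, ?_⟩
  have hcM : (MSS G).ncard = M.card := by
    rw [← Set.ncard_coe_finset]
    congr 1
    ext S
    exact (hMSS S).symm
  have hcv : mssOn G {v} = (M.filter (v ∈ ·)).card := by
    rw [mssOn, ← Set.ncard_coe_finset]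
    congr 1
    ext S
    simp [hMSS]
  have hFc : F.card = M.card := Finset.card_image_of_injOn hinj
  have hFv : (F.filter (v ∈ ·)).card = (M.filter (v ∉ ·)).card := by
    rw [hF, Finset.filter_image, Finset.card_image_of_injOn]
    · congr 1
      ext S
      simp [hφm, hvW]
    · exact hinj.mono (Finset.coe_subset.2 (Finset.filter_subset _ _))
  have hsplit := Finset.card_filter_add_card_filter_not (s := M) (fun S => v ∈ S)
  unfold Rare
  unfold Abundant at hab
  omega

/-- Subcubic bipartite graphs satisfy Frankl's conjecture: if every vertex has degree at
most `3` and the graph is bipartite with at least one edge, then each bipartition class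
contains a rare vertex. -/
theorem subcubic_bipartite_frankl {V : Type} [Fintype V] (G : SimpleGraph V) (U W : Set V)
    (hb : IsBipartition G U W) (he : G.edgeSet.Nonempty)
    (hdeg : ∀ v, (G.neighborSet v).ncard ≤ 3) :
    (∃ u ∈ U, Rare G u) ∧ (∃ w ∈ W, Rare G w) := by
  obtain ⟨h1, h2, h3, h4⟩ := hb
  exact ⟨exists_rare_of_isBipartition G W U ⟨Set.union_comm U W ▸ h1, h2.symm, h4, h3⟩ he hdeg,
    exists_rare_of_isBipartition G U W ⟨h1, h2, h3, h4⟩ he hdeg⟩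
end

section
/- Let G be a finite simple graph with a bipartition, and suppose there are pairwise distinct vertices u, v_1, …, v_k (k ≥ 1, each v_i ≠ u) such that N(u) = N(v_1) ∪ ⋯ ∪ N(v_k). Then every vertex w ≠ u that is rare in the induced subgraph G − u is also rare in G. -/
/-- A maximal stable set contains every vertex that has no neighbour in it. -/
theorem IsMaxStable.mem_iff {V : Type*} {G : SimpleGraph V} {S : Set V} (hS : IsMaxStable G S)
    (x : V) : x ∈ S ↔ ∀ y ∈ S, ¬G.Adj x y := by
  refine ⟨fun hx y hy => hS.1 hx hy, fun h => ?_⟩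
  by_contra hx
  obtain ⟨y, hy, hxy⟩ := hS.2 x hx
  exact h y hy hxy

/-- If `N(u)` is covered by neighbourhoods of other vertices that are contained in `N(u)`,
then deleting `u` is a bijection from the maximal stable sets of `G` to those of `G - u`. -/
theorem bijOn_MSS_delete {V : Type*} {G : SimpleGraph V} {u : V}
    (h : ∀ x, G.Adj u x → ∃ y, y ≠ u ∧ G.Adj y x ∧ G.neighborSet y ⊆ G.neighborSet u) :
    Set.BijOn (fun S : Set V => (Subtype.val ⁻¹' S : Set {x : V | x ≠ u}))
      (MSS G) (MSS (G.induce {x : V | x ≠ u})) := by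
  refine ⟨fun S hS => ⟨fun a ha b hb => hS.1 ha hb, ?_⟩, fun S hS T hT hST => ?_, fun T hT => ?_⟩
  · rintro ⟨x, hx⟩ hxS
    obtain ⟨z, hz, hxz⟩ := hS.2 x hxS
    by_cases hzu : z = u
    · subst hzu
      obtain ⟨y, hyz, hyx, hy⟩ := h x hxz.symm
      exact ⟨⟨y, hyz⟩, (hS.mem_iff y).2 fun t ht hyt => hS.1 hz ht (hy hyt), hyx.symm⟩
    · exact ⟨⟨z, hzu⟩, hz, hxz⟩
  · have key : ∀ x, x ≠ u → (x ∈ S ↔ x ∈ T) := fun x hx =>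
      Set.ext_iff.1 hST ⟨x, hx⟩
    ext x
    by_cases hx : x = u
    · subst hx
      rw [IsMaxStable.mem_iff hS, IsMaxStable.mem_iff hT]
      exact ⟨fun H y hy hxy => H y ((key y hxy.ne').2 hy) hxy,
        fun H y hy hxy => H y ((key y hxy.ne').1 hy) hxy⟩
    · exact key x hx
  · have restrict : ∀ x (hx : x ≠ u), (⟨x, hx⟩ : {x : V | x ≠ u}) ∉ T →
        ∃ y ∈ Subtype.val '' T, G.Adj x y := fun x hx hxT => by
      obtain ⟨y, hy, hxy⟩ := hT.2 ⟨x, hx⟩ hxT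
      exact ⟨y, ⟨y, hy, rfl⟩, hxy⟩
    have stable : IsStable G (Subtype.val '' T) := by
      rintro _ ⟨a, ha, rfl⟩ _ ⟨b, hb, rfl⟩
      exact hT.1 ha hb
    by_cases hu : ∃ y ∈ Subtype.val '' T, G.Adj u y
    · refine ⟨Subtype.val '' T, ⟨stable, fun x hx => ?_⟩,
        Set.preimage_image_eq T Subtype.val_injective⟩
      by_cases hxu : x = u
      · exact hxu ▸ hu
      · exact restrict x hxu fun hxT => hx ⟨_, hxT, rfl⟩
    · push Not at hu
      refine ⟨insert u (Subtype.val '' T), ⟨?_, fun x hx => ?_⟩, ?_⟩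
      · rintro a (rfl | ha) b (rfl | hb)
        · exact G.irrefl
        · exact hu b hb
        · exact fun hab => hu a ha hab.symm
        · exact stable ha hb
      · have hxu : x ≠ u := fun hxu => hx (Or.inl hxu)
        obtain ⟨y, hy, hxy⟩ := restrict x hxu fun hxT => hx (Or.inr ⟨_, hxT, rfl⟩)
        exact ⟨y, Or.inr hy, hxy⟩
      · ext ⟨x, hx⟩
        have hx' : x ≠ u := hx
        simp [hx']

/-- If `N(u)` is the union of the neighbourhoods of pairwise distinct vertices
`v 0, …, v (k-1)` all different from `u`, then any vertex `w ≠ u` that is rare in the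
induced subgraph `G - u` is also rare in `G`. -/
theorem rare_of_rare_delete {V : Type} [Fintype V] (G : SimpleGraph V)
    (hb : ∃ U W, IsBipartition G U W) (u : V) (k : ℕ) (hk : 1 ≤ k)
    (v : Fin k → V) (hinj : Function.Injective v) (hne : ∀ i, v i ≠ u)
    (hN : G.neighborSet u = ⋃ i, G.neighborSet (v i))
    (w : V) (hw : w ≠ u)
    (hrare : Rare (G.induce {x : V | x ≠ u}) ⟨w, hw⟩) :
    Rare G w := by
  have hbij := bijOn_MSS_delete (G := G) (u := u) fun x hx => by
    obtain ⟨i, hi⟩ := Set.mem_iUnion.1 (hN ▸ (show x ∈ G.neighborSet u from hx))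
    exact ⟨v i, hne i, hi, hN ▸ Set.subset_iUnion (fun i => G.neighborSet (v i)) i⟩
  have hcard : (MSS (G.induce {x : V | x ≠ u})).ncard = (MSS G).ncard := by
    rw [← hbij.image_eq, hbij.injOn.ncard_image]
  have hcard_w : mssOn (G.induce {x : V | x ≠ u}) {⟨w, hw⟩} = mssOn G {w} := by
    unfold mssOn
    rw [← (hbij.injOn.mono (Set.sep_subset (MSS G) fun S => {w} ⊆ S)).ncard_image]
    congr 1
    ext T
    constructor
    · rintro ⟨hT, hwT⟩
      obtain ⟨S, hS, rfl⟩ := hbij.surjOn hT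
      have hwS : w ∈ S := hwT (Set.mem_singleton _)
      exact ⟨S, ⟨hS, Set.singleton_subset_iff.2 hwS⟩, rfl⟩
    · rintro ⟨S, ⟨hS, hwS⟩, rfl⟩
      exact ⟨hbij.mapsTo hS, Set.singleton_subset_iff.2 (hwS (Set.mem_singleton w))⟩
  rwa [Rare, hcard, hcard_w] at hrare
end
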